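/- arXiv:2507.14005 — 5 statements merged into one kernel-verified Lean document; each statement's English description precedes it below -/
import Mathlib

section
/- For every risk-dependent policy π̃, every initial risk level α ∈ (0,1], and every state-level perturbation family ξ̃ ∈ Ξ̃, the mapped history perturbation ζ_α^{ξ̃} is a valid history perturbation for the induced history-dependent policy: 0 ≤ ζ_α^{ξ̃}(H) ≤ 1/α for every length-T history H, and Σ_H P^{π_h^{π̃,ξ̃,α}}(H)·ζ_α^{ξ̃}(H) = 1, i.e. ζ_α^{ξ̃} ∈ U_α(P^{π_h^{π̃,ξ̃,α}}). -/
open Finset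

section CVaRDefs

attribute [local instance] Classical.propDecidable

variable {S A : Type*}

/-- Risk envelope `U_y(p)` for a pmf `p` on a finite type `Ω`. -/
def RiskEnv {Ω : Type*} [Fintype Ω] (y : ℝ) (p : Ω → ℝ) (ξ : Ω → ℝ) : Prop :=
  (∀ ω, 0 ≤ ξ ω ∧ ξ ω ≤ 1 / y) ∧ ∑ ω, p ω * ξ ω = 1

/-- State at time `k` along a history `H` starting from `s`
    (a history records, at each step, the action taken and the next state). -/
def stAt (s : S) {t : ℕ} (H : Fin t → A × S) : ℕ → S
  | 0 => s
  | k + 1 => if h : k < t then (H ⟨k, h⟩).2 else s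

/-- Length-`k` prefix of a history (junk values beyond `t`). -/
noncomputable def pre [Nonempty S] [Nonempty A] {t : ℕ} (H : Fin t → A × S) (k : ℕ) :
    Fin k → A × S :=
  fun i => if h : (i : ℕ) < t then H ⟨i, h⟩ else Classical.arbitrary _

/-- Deterministic history-dependent policies. -/
abbrev HPolicy (S A : Type*) := ∀ k : ℕ, (Fin k → A × S) → A

/-- Probability of history `H` under transition kernel `P` and policy `πh`, starting from `s`. -/
noncomputable def histProb [Nonempty S] [Nonempty A] (P : S → A → S → ℝ) (s : S)
    (πh : HPolicy S A) {t : ℕ} (H : Fin t → A × S) : ℝ :=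
  ∏ k : Fin t,
    P (stAt s H k) (H k).1 (H k).2 * (if (H k).1 = πh k (pre H k) then 1 else 0)

/-- Discounted return of history `H` starting from `s`. -/
def ret (R : S → A → S → ℝ) (γ : ℝ) (s : S) {t : ℕ} (H : Fin t → A × S) : ℝ :=
  ∑ k : Fin t, γ ^ (k : ℕ) * R (stAt s H k) (H k).1 (H k).2

/-- Static CVaR of a history-dependent policy at level `α` (dual formulation). -/
noncomputable def staticCVaR [Fintype S] [Fintype A] [Nonempty S] [Nonempty A]
    (P R : S → A → S → ℝ) (γ : ℝ) (s : S) (T : ℕ) (πh : HPolicy S A) (α : ℝ) : ℝ :=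
  sInf {x | ∃ ξ : (Fin T → A × S) → ℝ,
    RiskEnv α (fun H => histProb P s πh H) ξ ∧
    x = ∑ H : Fin T → A × S, histProb P s πh H * ξ H * ret R γ s H}

/-- A valid state-level perturbation family (with the convention `ξ̃(·|s,0,a) ≡ 1`). -/
def ValidFamily [Fintype S] (P : S → A → S → ℝ) (ξt : S → ℝ → A → S → ℝ) : Prop :=
  (∀ s y a, 0 < y → y ≤ 1 → RiskEnv y (P s a) (ξt s y a)) ∧
  ∀ s a s', ξt s 0 a s' = 1

/-- Policy–perturbation value function `V^{π̃,ξ̃}_t`. -/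
def Vxi [Fintype S] (P R : S → A → S → ℝ) (γ : ℝ) (πt : S → ℝ → A)
    (ξt : S → ℝ → A → S → ℝ) : ℕ → S → ℝ → ℝ
  | 0, _, _ => 0
  | t + 1, s, y =>
    ∑ s' : S, P s (πt s y) s' * ξt s y (πt s y) s' *
      (R s (πt s y) s' + γ * Vxi P R γ πt ξt t s' (y * ξt s y (πt s y) s'))

/-- Risk-dependent value function `V^{π̃}_t` (dynamic-programming CVaR evaluation). -/
noncomputable def Vdp [Fintype S] (P R : S → A → S → ℝ) (γ : ℝ) (πt : S → ℝ → A) :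
    ℕ → S → ℝ → ℝ
  | 0, _, _ => 0
  | t + 1, s, y =>
    sInf {x | ∃ ξ : S → ℝ, RiskEnv y (P s (πt s y)) ξ ∧
      x = ∑ s' : S, P s (πt s y) s' * ξ s' *
        (R s (πt s y) s' + γ * Vdp P R γ πt t s' (y * ξ s'))}

/-- Risk level `Y_k` at time `k` along history `H`, starting from `Y₀ = α`. -/
def riskAt (ξt : S → ℝ → A → S → ℝ) (s : S) (α : ℝ) {t : ℕ} (H : Fin t → A × S) :
    ℕ → ℝ
  | 0 => α
  | k + 1 =>
    riskAt ξt s α H k *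
      if h : k < t then ξt (stAt s H k) (riskAt ξt s α H k) (H ⟨k, h⟩).1 (H ⟨k, h⟩).2 else 1

/-- Mapped history perturbation `ζ_α^{ξ̃}`. -/
def zeta (ξt : S → ℝ → A → S → ℝ) (s : S) (α : ℝ) {t : ℕ} (H : Fin t → A × S) : ℝ :=
  ∏ k : Fin t, ξt (stAt s H k) (riskAt ξt s α H k) (H k).1 (H k).2

/-- History-dependent policy induced by `(π̃, ξ̃, α)` from initial state `s`. -/
def inducedPolicy (πt : S → ℝ → A) (ξt : S → ℝ → A → S → ℝ) (s : S) (α : ℝ) :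
    HPolicy S A :=
  fun k H => πt (stAt s H k) (riskAt ξt s α H k)

/-- `ξ̃` attains the minima in the risk-dependent value recursion (at every augmented state). -/
def AttainsMin [Fintype S] (P R : S → A → S → ℝ) (γ : ℝ) (πt : S → ℝ → A)
    (ξt : S → ℝ → A → S → ℝ) : Prop :=
  ∀ t : ℕ, ∀ s : S, ∀ y : ℝ, 0 < y → y ≤ 1 →
    Vdp P R γ πt (t + 1) s y =
      ∑ s' : S, P s (πt s y) s' * ξt s y (πt s y) s' *
        (R s (πt s y) s' + γ * Vdp P R γ πt t s' (y * ξt s y (πt s y) s'))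

/-- Risk-propagation and state-level-envelope constraints of a risk-level assignment `Y`
    with respect to policy `πh`, initial level `α`, and history perturbation `ξ`. -/
def StructConsistent [Fintype S] [Fintype A] [Nonempty S] [Nonempty A]
    (P : S → A → S → ℝ) (s0 : S) (T : ℕ) (πh : HPolicy S A) (α : ℝ)
    (ξ : (Fin T → A × S) → ℝ) (Y : ∀ k : ℕ, (Fin k → A × S) → ℝ) : Prop :=
  ∀ H : Fin T → A × S, 0 < histProb P s0 πh H →
    (Y 0 (pre H 0) = α ∧ Y T H = α * ξ H) ∧
    ∀ t : ℕ, ∀ ht : t < T,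
      ∑ s' : S, P (stAt s0 H t) (H ⟨t, ht⟩).1 s' *
        (Y (t + 1) (Fin.snoc (pre H t) ((H ⟨t, ht⟩).1, s')) / Y t (pre H t)) = 1

/-- Action-selection consistency constraints of a risk-level assignment `Y` with respect to the
    risk-dependent policy `πt` along positive-probability histories of `πh`. -/
def ActionConsistent [Fintype S] [Fintype A] [Nonempty S] [Nonempty A]
    (P : S → A → S → ℝ) (s0 : S) (T : ℕ) (πh : HPolicy S A)
    (πt : S → ℝ → A) (Y : ∀ k : ℕ, (Fin k → A × S) → ℝ) : Prop :=
  ∀ H : Fin T → A × S, 0 < histProb P s0 πh H →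
    ∀ t : ℕ, ∀ ht : t < T, πt (stAt s0 H t) (Y t (pre H t)) = (H ⟨t, ht⟩).1

end CVaRDefs

theorem aux_stAt {S A : Type*} (s : S) {t : ℕ} (H : Fin t → A × S) (x : A × S) (k : ℕ)
    (hk : k ≤ t) : stAt s (Fin.snoc (α := fun _ => A × S) H x) k = stAt s H k := by
  cases k with
  | zero => rfl
  | succ k =>
    have h1 : k < t := hk
    have h2 : k < t + 1 := by omega
    simp [stAt, h1, h2, Fin.snoc]

theorem aux_riskAt {S A : Type*} (ξt : S → ℝ → A → S → ℝ) (s : S) (α : ℝ) {t : ℕ}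
    (H : Fin t → A × S) (x : A × S) (k : ℕ) (hk : k ≤ t) :
    riskAt ξt s α (Fin.snoc (α := fun _ => A × S) H x) k = riskAt ξt s α H k := by
  induction k with
  | zero => rfl
  | succ k ih =>
    have h1 : k < t := hk
    have h2 : k < t + 1 := by omega
    have h3 := aux_stAt s H x k (by omega)
    have h4 : (Fin.snoc (α := fun _ => A × S) H x) ⟨k, h2⟩ = H ⟨k, h1⟩ := by
      simp [Fin.snoc, h1]
    simp only [riskAt]
    rw [dif_pos h1, dif_pos h2, h3, ih (by omega), h4]

theorem aux_pre {S A : Type*} [Nonempty S] [Nonempty A] {t : ℕ}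
    (H : Fin t → A × S) (x : A × S) (k : ℕ) (hk : k ≤ t) :
    pre (Fin.snoc (α := fun _ => A × S) H x) k = pre H k := by
  funext i
  have h1 : (i : ℕ) < t := by omega
  have h2 : (i : ℕ) < t + 1 := by omega
  simp [pre, h1, h2, Fin.snoc]

theorem aux_pre_self {S A : Type*} [Nonempty S] [Nonempty A] {t : ℕ}
    (H : Fin t → A × S) : pre H t = H := by
  funext i
  simp [pre]

theorem aux_zeta {S A : Type*} (ξt : S → ℝ → A → S → ℝ) (s : S) (α : ℝ) {t : ℕ}
    (H : Fin t → A × S) (x : A × S) :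
    zeta ξt s α (Fin.snoc (α := fun _ => A × S) H x) =
      zeta ξt s α H * ξt (stAt s H t) (riskAt ξt s α H t) x.1 x.2 := by
  unfold zeta
  rw [Fin.prod_univ_castSucc]
  congr 1
  · refine Finset.prod_congr rfl fun k _ => ?_
    rw [Fin.snoc_castSucc, Fin.val_castSucc, aux_stAt _ _ _ _ k.2.le, aux_riskAt _ _ _ _ _ _ k.2.le]
  · rw [Fin.snoc_last, Fin.val_last, aux_stAt _ _ _ _ le_rfl, aux_riskAt _ _ _ _ _ _ le_rfl]

open Classical in
theorem aux_hist {S A : Type*} [Nonempty S] [Nonempty A] (P : S → A → S → ℝ) (s : S)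
    (πh : HPolicy S A) {t : ℕ} (H : Fin t → A × S) (x : A × S) :
    histProb P s πh (Fin.snoc (α := fun _ => A × S) H x) =
      histProb P s πh H * (P (stAt s H t) x.1 x.2 * (if x.1 = πh t H then 1 else 0)) := by
  unfold histProb
  rw [Fin.prod_univ_castSucc]
  congr 1
  · refine Finset.prod_congr rfl fun k _ => ?_
    rw [Fin.snoc_castSucc, Fin.val_castSucc, aux_stAt _ _ _ _ k.2.le, aux_pre _ _ _ k.2.le]
  · rw [Fin.snoc_last, Fin.val_last, aux_stAt _ _ _ _ le_rfl, aux_pre _ _ _ le_rfl, aux_pre_self]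

theorem aux_step {S A : Type*} [Fintype S] (P : S → A → S → ℝ) (ξt : S → ℝ → A → S → ℝ)
    (hξt : ValidFamily P ξt) (s : S) (y : ℝ) (a : A) (s' : S) (h0 : 0 ≤ y) (h1 : y ≤ 1) :
    0 ≤ ξt s y a s' ∧ 0 ≤ y * ξt s y a s' ∧ y * ξt s y a s' ≤ 1 := by
  rcases h0.eq_or_lt with rfl | h
  · rw [hξt.2]; norm_num
  · obtain ⟨h2, h3⟩ := (hξt.1 s y a h h1).1 s'
    refine ⟨h2, mul_nonneg h0 h2, ?_⟩
    rw [le_div_iff₀ h] at h3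
    linarith

theorem aux_sum {S A : Type*} [Fintype S] (P : S → A → S → ℝ) (ξt : S → ℝ → A → S → ℝ)
    (hP : ∀ s a, (∀ s', 0 ≤ P s a s') ∧ ∑ s', P s a s' = 1)
    (hξt : ValidFamily P ξt) (s : S) (y : ℝ) (a : A) (h0 : 0 ≤ y) (h1 : y ≤ 1) :
    ∑ s', P s a s' * ξt s y a s' = 1 := by
  rcases h0.eq_or_lt with rfl | h
  · simp only [hξt.2, mul_one]; exact (hP s a).2
  · exact (hξt.1 s y a h h1).2

theorem aux_risk {S A : Type*} [Fintype S] (P : S → A → S → ℝ) (ξt : S → ℝ → A → S → ℝ)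
    (hξt : ValidFamily P ξt) (s : S) (α : ℝ) (h0 : 0 < α) (h1 : α ≤ 1) {t : ℕ}
    (H : Fin t → A × S) (k : ℕ) : 0 ≤ riskAt ξt s α H k ∧ riskAt ξt s α H k ≤ 1 := by
  induction k with
  | zero => exact ⟨h0.le, h1⟩
  | succ k ih =>
    simp only [riskAt]
    split_ifs with h
    · exact (aux_step P ξt hξt _ _ _ _ ih.1 ih.2).2
    · simpa using ih

theorem aux_zeta_risk {S A : Type*} (ξt : S → ℝ → A → S → ℝ) (s : S) (α : ℝ) {t : ℕ}
    (H : Fin t → A × S) : α * zeta ξt s α H = riskAt ξt s α H t := by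
  have key : ∀ k : ℕ, ∀ hk : k ≤ t, α * ∏ i : Fin k,
      ξt (stAt s H i) (riskAt ξt s α H i) (H (Fin.castLE hk i)).1 (H (Fin.castLE hk i)).2 =
        riskAt ξt s α H k := by
    intro k
    induction k with
    | zero => intro _; simp [riskAt]
    | succ k ih =>
      intro hk
      have h1 : k < t := hk
      rw [Fin.prod_univ_castSucc, ← mul_assoc]
      have := ih h1.le
      simp only [riskAt]
      rw [dif_pos h1, ← this]
      congr 1
      rw [this]
      rfl
  exact key t le_rfl

/-- validity of the mapped history perturbation:
for every risk-dependent policy `π̃`, initial risk level `α ∈ (0,1]`, and state-level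
perturbation family `ξ̃ ∈ Ξ̃`, the mapped perturbation `ζ_α^{ξ̃}` is a valid history
perturbation for the induced history-dependent policy:
`0 ≤ ζ_α^{ξ̃}(H) ≤ 1/α` for every length-`T` history `H`, and
`Σ_H P^{π_h^{π̃,ξ̃,α}}(H)·ζ_α^{ξ̃}(H) = 1`, i.e. `ζ_α^{ξ̃} ∈ U_α(P^{π_h^{π̃,ξ̃,α}})`. -/
theorem stmt1 {S A : Type*} [Fintype S] [Fintype A] [Nonempty S] [Nonempty A]
    (P R : S → A → S → ℝ) (γ : ℝ) (hγ0 : 0 < γ) (hγ1 : γ ≤ 1)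
    (hP : ∀ s a, (∀ s', 0 ≤ P s a s') ∧ ∑ s', P s a s' = 1)
    (s0 : S) (T : ℕ) (πt : S → ℝ → A)
    (ξt : S → ℝ → A → S → ℝ) (hξt : ValidFamily P ξt)
    (α : ℝ) (hα0 : 0 < α) (hα1 : α ≤ 1) :
    RiskEnv α (fun H : Fin T → A × S => histProb P s0 (inducedPolicy πt ξt s0 α) H)
      (fun H : Fin T → A × S => zeta ξt s0 α H) := by
  classical
  refine ⟨fun H => ⟨?_, ?_⟩, ?_⟩
  · refine Finset.prod_nonneg fun k _ => ?_
    have h := aux_risk P ξt hξt s0 α hα0 hα1 H k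
    exact (aux_step P ξt hξt _ _ _ _ h.1 h.2).1
  · have h := aux_risk P ξt hξt s0 α hα0 hα1 H T
    rw [← aux_zeta_risk] at h
    rw [le_div_iff₀ hα0]
    linarith [h.2]
  · induction T with
    | zero => simp [histProb, zeta]
    | succ t ih =>
      rw [← ih, ← (Fin.snocEquiv (fun _ => A × S)).sum_comp, Fintype.sum_prod_type_right]
      refine Finset.sum_congr rfl fun H _ => ?_
      have h := aux_risk P ξt hξt s0 α hα0 hα1 H t
      have hs := aux_sum P ξt hP hξt (stAt s0 H t) (riskAt ξt s0 α H t)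
        (inducedPolicy πt ξt s0 α t H) h.1 h.2
      have e : ∀ x : A × S, (Fin.snocEquiv (fun _ : Fin (t + 1) => A × S)) (x, H) =
        Fin.snoc (α := fun _ => A × S) H x := fun _ => rfl
      simp only [e, aux_zeta, aux_hist]
      calc _ = ∑ x : A × S, histProb P s0 (inducedPolicy πt ξt s0 α) H * zeta ξt s0 α H *
            (if x.1 = inducedPolicy πt ξt s0 α t H then
              P (stAt s0 H t) x.1 x.2 * ξt (stAt s0 H t) (riskAt ξt s0 α H t) x.1 x.2 else 0) := by
            refine Finset.sum_congr rfl fun x _ => ?_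
            split_ifs <;> ring
        _ = histProb P s0 (inducedPolicy πt ξt s0 α) H * zeta ξt s0 α H * 1 := by
            rw [← Finset.mul_sum, ← hs, Fintype.sum_prod_type_right]
            simp
        _ = _ := mul_one _
end

section
/- For every risk-dependent policy π̃, every initial risk level α ∈ (0,1], and every state-level perturbation family ξ̃ ∈ Ξ̃, the ζ-reweighted expected return over length-T histories recovers the policy-perturbation value function at the initial augmented state: Σ_H P^{π_h^{π̃,ξ̃,α}}(H)·ζ_α^{ξ̃}(H)·R^H = V^{π̃,ξ̃}(s₀, α). -/
open Finset

section CVaRDefs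

attribute [local instance] Classical.propDecidable

variable {S A : Type*}

end CVaRDefs

section Helpers

attribute [local instance] Classical.propDecidable

variable {S A : Type*}

theorem stAt_pre [Nonempty S] [Nonempty A] (s : S) {t : ℕ} (H : Fin t → A × S) (k j : ℕ)
    (hk : k ≤ t) (hj : j ≤ k) : stAt s (pre H k) j = stAt s H j := by
  cases j with
  | zero => rfl
  | succ j =>
    have h1 : j < k := hj
    have h2 : j < t := by omega
    simp [stAt, pre, h1, h2]

theorem riskAt_pre [Nonempty S] [Nonempty A] (ξt : S → ℝ → A → S → ℝ) (s : S) (α : ℝ) {t : ℕ}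
    (H : Fin t → A × S) (k j : ℕ)
    (hk : k ≤ t) (hj : j ≤ k) : riskAt ξt s α (pre H k) j = riskAt ξt s α H j := by
  induction j with
  | zero => rfl
  | succ j ih =>
    have h1 : j < k := hj
    have h2 : j < t := by omega
    simp only [riskAt, h1, h2, dif_pos, ih h1.le, stAt_pre s H k j hk h1.le]
    simp [pre, h2]

theorem stAt_cons (s : S) {t : ℕ} (x : A × S) (H : Fin t → A × S) (k : ℕ) (hk : k ≤ t) :
    stAt s (Fin.cons x H : Fin (t + 1) → A × S) (k + 1) = stAt x.2 H k := by
  cases k with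
  | zero => simp [stAt]
  | succ k =>
    have h1 : k < t := hk
    have h2 : k + 1 < t + 1 := by omega
    rw [stAt, dif_pos h2, stAt, dif_pos h1]
    rfl

theorem riskAt_cons (ξt : S → ℝ → A → S → ℝ) (s : S) (α : ℝ) {t : ℕ} (x : A × S)
    (H : Fin t → A × S) (k : ℕ) (hk : k ≤ t) :
    riskAt ξt s α (Fin.cons x H : Fin (t + 1) → A × S) (k + 1) =
      riskAt ξt x.2 (α * ξt s α x.1 x.2) H k := by
  induction k with
  | zero => simp [riskAt, stAt]
  | succ k ih =>
    have h1 : k < t := hk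
    have h2 : (⟨k + 1, by omega⟩ : Fin (t + 1)) = Fin.succ ⟨k, h1⟩ := rfl
    have h3 : k + 1 < t + 1 := by omega
    rw [riskAt, ih h1.le, stAt_cons s x H k h1.le, dif_pos h3, riskAt, dif_pos h1, h2,
      Fin.cons_succ]

/-- Reweighted probability of a history under the induced policy. -/
noncomputable def wt (P : S → A → S → ℝ) (πt : S → ℝ → A) (ξt : S → ℝ → A → S → ℝ) (s : S)
    (y : ℝ) {t : ℕ} (H : Fin t → A × S) : ℝ :=
  ∏ k : Fin t, (P (stAt s H k) (H k).1 (H k).2 *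
    (if (H k).1 = πt (stAt s H k) (riskAt ξt s y H k) then 1 else 0)) *
    ξt (stAt s H k) (riskAt ξt s y H k) (H k).1 (H k).2

theorem wt_eq [Nonempty S] [Nonempty A] (P : S → A → S → ℝ) (πt : S → ℝ → A)
    (ξt : S → ℝ → A → S → ℝ) (s : S) (y : ℝ) {t : ℕ} (H : Fin t → A × S) :
    histProb P s (inducedPolicy πt ξt s y) H * zeta ξt s y H = wt P πt ξt s y H := by
  unfold histProb zeta wt inducedPolicy
  rw [← Finset.prod_mul_distrib]
  refine Finset.prod_congr rfl fun k _ => ?_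
  rw [stAt_pre s H k k k.2.le le_rfl, riskAt_pre ξt s y H k k k.2.le le_rfl]

theorem wt_cons (P : S → A → S → ℝ) (πt : S → ℝ → A)
    (ξt : S → ℝ → A → S → ℝ) (s : S) (y : ℝ) {t : ℕ} (x : A × S) (H : Fin t → A × S) :
    wt P πt ξt s y (Fin.cons x H : Fin (t + 1) → A × S) =
      (P s x.1 x.2 * (if x.1 = πt s y then 1 else 0)) * ξt s y x.1 x.2 *
        wt P πt ξt x.2 (y * ξt s y x.1 x.2) H := by
  unfold wt
  rw [Fin.prod_univ_succ]
  congr 1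
  refine Finset.prod_congr rfl fun k _ => ?_
  rw [Fin.val_succ, stAt_cons s x H k k.2.le, riskAt_cons ξt s y x H k k.2.le, Fin.cons_succ]

theorem ret_cons (R : S → A → S → ℝ) (γ : ℝ) (s : S) {t : ℕ} (x : A × S) (H : Fin t → A × S) :
    ret R γ s (Fin.cons x H : Fin (t + 1) → A × S) = R s x.1 x.2 + γ * ret R γ x.2 H := by
  unfold ret
  rw [Fin.sum_univ_succ, Finset.mul_sum]
  congr 1
  · simp [stAt]
  · refine Finset.sum_congr rfl fun k _ => ?_
    rw [Fin.val_succ, stAt_cons s x H k k.2.le, Fin.cons_succ]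
    ring

theorem sum_hist_cons [Fintype S] [Fintype A] {t : ℕ} (f : (Fin (t + 1) → A × S) → ℝ) :
    ∑ H, f H = ∑ a : A, ∑ s' : S, ∑ H : Fin t → A × S, f (Fin.cons (a, s') H) := by
  rw [← (Fin.consEquiv (fun _ : Fin (t + 1) => A × S)).sum_comp, Fintype.sum_prod_type,
    Fintype.sum_prod_type]
  rfl

theorem sum_wt_cons [Fintype S] [Fintype A] (P : S → A → S → ℝ) (πt : S → ℝ → A)
    (ξt : S → ℝ → A → S → ℝ) (s : S) (y : ℝ) {t : ℕ} (g : (Fin (t + 1) → A × S) → ℝ) :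
    ∑ H : Fin (t + 1) → A × S, wt P πt ξt s y H * g H =
      ∑ s' : S, P s (πt s y) s' * ξt s y (πt s y) s' *
        ∑ H : Fin t → A × S, wt P πt ξt s' (y * ξt s y (πt s y) s') H *
          g (Fin.cons (πt s y, s') H) := by
  rw [sum_hist_cons, Finset.sum_eq_single (πt s y)]
  · refine Finset.sum_congr rfl fun s' _ => ?_
    rw [Finset.mul_sum]
    refine Finset.sum_congr rfl fun H _ => ?_
    rw [wt_cons, if_pos rfl]
    ring
  · intro a _ ha
    refine Finset.sum_eq_zero fun s' _ => Finset.sum_eq_zero fun H _ => ?_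
    rw [wt_cons, if_neg ha]
    ring
  · intro h
    exact absurd (Finset.mem_univ _) h

theorem env_facts [Fintype S] (P : S → A → S → ℝ)
    (hP : ∀ s a, (∀ s', 0 ≤ P s a s') ∧ ∑ s', P s a s' = 1)
    (ξt : S → ℝ → A → S → ℝ) (hξt : ValidFamily P ξt) (s : S) (y : ℝ) (a : A)
    (h0 : 0 ≤ y) (h1 : y ≤ 1) :
    (∑ s', P s a s' * ξt s y a s' = 1) ∧
      ∀ s', 0 ≤ y * ξt s y a s' ∧ y * ξt s y a s' ≤ 1 := by
  rcases h0.eq_or_lt with rfl | hy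
  · simp [hξt.2, (hP s a).2]
  · obtain ⟨hb, hs⟩ := hξt.1 s y a hy h1
    refine ⟨hs, fun s' => ⟨mul_nonneg h0 (hb s').1, ?_⟩⟩
    have := mul_le_mul_of_nonneg_left (hb s').2 h0
    rwa [mul_one_div_cancel hy.ne'] at this

theorem sum_wt [Fintype S] [Fintype A] (P : S → A → S → ℝ)
    (hP : ∀ s a, (∀ s', 0 ≤ P s a s') ∧ ∑ s', P s a s' = 1) (πt : S → ℝ → A)
    (ξt : S → ℝ → A → S → ℝ) (hξt : ValidFamily P ξt) (t : ℕ) : ∀ (s : S) (y : ℝ),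
    0 ≤ y → y ≤ 1 → ∑ H : Fin t → A × S, wt P πt ξt s y H = 1 := by
  induction t with
  | zero => intro s y _ _; simp [wt]
  | succ t ih =>
    intro s y h0 h1
    obtain ⟨hs, hb⟩ := env_facts P hP ξt hξt s y (πt s y) h0 h1
    have := sum_wt_cons (t := t) P πt ξt s y (fun _ => 1)
    simp only [mul_one] at this
    rw [this, ← hs]
    refine Finset.sum_congr rfl fun s' _ => ?_
    rw [ih s' _ (hb s').1 (hb s').2, mul_one]

theorem sum_wt_ret [Fintype S] [Fintype A] (P R : S → A → S → ℝ) (γ : ℝ)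
    (hP : ∀ s a, (∀ s', 0 ≤ P s a s') ∧ ∑ s', P s a s' = 1) (πt : S → ℝ → A)
    (ξt : S → ℝ → A → S → ℝ) (hξt : ValidFamily P ξt) (t : ℕ) : ∀ (s : S) (y : ℝ),
    0 ≤ y → y ≤ 1 →
      ∑ H : Fin t → A × S, wt P πt ξt s y H * ret R γ s H = Vxi P R γ πt ξt t s y := by
  induction t with
  | zero => intro s y _ _; simp [ret, Vxi]
  | succ t ih =>
    intro s y h0 h1
    obtain ⟨hs, hb⟩ := env_facts P hP ξt hξt s y (πt s y) h0 h1
    rw [sum_wt_cons, Vxi]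
    refine Finset.sum_congr rfl fun s' _ => ?_
    congr 1
    rw [← ih s' _ (hb s').1 (hb s').2, Finset.mul_sum]
    simp only [ret_cons, mul_add, Finset.sum_add_distrib]
    rw [← Finset.sum_mul, sum_wt P hP πt ξt hξt t s' _ (hb s').1 (hb s').2, one_mul]
    congr 1
    exact Finset.sum_congr rfl fun H _ => by ring

end Helpers

/-- state-level perturbation evaluation correspondence at the initial state:
for every risk-dependent policy `π̃`, initial risk level `α ∈ (0,1]`, and state-level
perturbation family `ξ̃ ∈ Ξ̃`, the `ζ`-reweighted expected return over length-`T` histories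
recovers the policy-perturbation value function at the initial augmented state:
`Σ_H P^{π_h^{π̃,ξ̃,α}}(H)·ζ_α^{ξ̃}(H)·R^H = V^{π̃,ξ̃}(s₀, α)`. -/
theorem stmt2 {S A : Type*} [Fintype S] [Fintype A] [Nonempty S] [Nonempty A]
    (P R : S → A → S → ℝ) (γ : ℝ) (hγ0 : 0 < γ) (hγ1 : γ ≤ 1)
    (hP : ∀ s a, (∀ s', 0 ≤ P s a s') ∧ ∑ s', P s a s' = 1)
    (s0 : S) (T : ℕ) (πt : S → ℝ → A)
    (ξt : S → ℝ → A → S → ℝ) (hξt : ValidFamily P ξt)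
    (α : ℝ) (hα0 : 0 < α) (hα1 : α ≤ 1) :
    ∑ H : Fin T → A × S,
        histProb P s0 (inducedPolicy πt ξt s0 α) H * zeta ξt s0 α H * ret R γ s0 H =
      Vxi P R γ πt ξt T s0 α := by
  simp only [wt_eq]
  exact sum_wt_ret P R γ hP πt ξt hξt T s0 α hα0.le hα1
end

section
/- Impossibility of uniform optimality: in the counterexample MDP M★, no risk-dependent policy is uniformly optimal; that is, for every risk-dependent policy π̃ : S × [0,1] → A and every choice of minimizing family ξ̃⋆ defining the induced policies π̃_h^α, there exists an initial risk level α ∈ (0,1] such that CVaR_α[Z^{π̃_h^α}] < max_{π_h} CVaR_α[Z^{π_h}]. -/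
open Finset

section CVaRDefs

attribute [local instance] Classical.propDecidable

variable {S A : Type*}

end CVaRDefs

section Mstar

/-- Transition kernel of the counterexample MDP `M★` from Hau et al. (2023).
States `0,…,8` stand for `s₀,…,s₈`; actions `0,1,2` stand for `a₁,a₂,a₃`. -/
noncomputable def Pstar : Fin 9 → Fin 3 → Fin 9 → ℝ := fun s a s' =>
  if s = 0 then (if s' = 1 then 1 / 2 else if s' = 2 then 1 / 2 else 0)
  else if s = 1 then
    (if a = 0 then (if s' = 3 then 3 / 4 else if s' = 4 then 1 / 4 else 0)
     else if a = 1 then (if s' = 5 then 1 else 0)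
     else (if s' = 6 then 1 / 2 else if s' = 7 then 1 / 2 else 0))
  else if s = 2 then (if s' = 8 then 1 else 0)
  else (if s' = s then 1 else 0)

/-- Reward function of the counterexample MDP `M★`. -/
noncomputable def Rstar : Fin 9 → Fin 3 → Fin 9 → ℝ := fun s a s' =>
  if s = 1 then
    (if a = 0 then (if s' = 3 then 600 else if s' = 4 then -600 else 0)
     else if a = 1 then 0
     else (if s' = 6 then -100 else if s' = 7 then 400 else 0))
  else if s = 2 then 200 else 0

/-- The history-dependent policy `π^{(i)}` on `M★` selecting action `aᵢ` everywhere
(in particular at `s₁`, which is the only state where the choice matters). -/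
def piConst (i : Fin 3) : HPolicy (Fin 9) (Fin 3) := fun _ _ => i

end Mstar

/-- The action at `s₁` (time 1) under `πh`. -/
def actOne (πh : HPolicy (Fin 9) (Fin 3)) : Fin 3 :=
  πh 1 (fun _ => (πh 0 Fin.elim0, 1))

/-- The action at `s₂` (time 1) under `πh`. -/
def actTwo (πh : HPolicy (Fin 9) (Fin 3)) : Fin 3 :=
  πh 1 (fun _ => (πh 0 Fin.elim0, 2))

lemma histProb_two (πh : HPolicy (Fin 9) (Fin 3)) (x y : Fin 3 × Fin 9) :
    histProb Pstar 0 πh ![x, y] =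
      (Pstar 0 x.1 x.2 * if x.1 = πh 0 Fin.elim0 then 1 else 0) *
      (Pstar x.2 y.1 y.2 * if y.1 = πh 1 (fun _ => x) then 1 else 0) := by
  have h0 : pre ![x, y] 0 = Fin.elim0 := by
    funext i; exact i.elim0
  have h1 : pre ![x, y] 1 = fun _ => x := by
    funext i
    have : i = 0 := Subsingleton.elim _ _
    subst this
    simp [pre]
  unfold histProb
  rw [Fin.prod_univ_two]
  simp only [Fin.val_zero, Fin.val_one, h0, h1]
  simp only [stAt]
  simp only [Matrix.cons_val_zero, Matrix.cons_val_one]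
  congr

lemma sum_nine (F : Fin 9 → ℝ) :
    ∑ s, F s = F 0 + F 1 + F 2 + F 3 + F 4 + F 5 + F 6 + F 7 + F 8 := by
  rw [Fin.sum_univ_castSucc, Fin.sum_univ_eight]; rfl

lemma sum_hist (inst : Fintype (Fin 2 → Fin 3 × Fin 9)) (πh : HPolicy (Fin 9) (Fin 3))
    (f : (Fin 2 → Fin 3 × Fin 9) → ℝ) :
    @Finset.sum _ _ _ (@Finset.univ _ inst) (fun H => histProb Pstar 0 πh H * f H) =
      1 / 2 * (∑ s', Pstar 1 (actOne πh) s' * f ![(πh 0 Fin.elim0, 1), (actOne πh, s')]) +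
      1 / 2 * f ![(πh 0 Fin.elim0, 2), (actTwo πh, 8)] := by
  rw [← (finTwoArrowEquiv (Fin 3 × Fin 9)).symm.sum_comp, Fintype.sum_prod_type]
  simp only [finTwoArrowEquiv_symm_apply, histProb_two]
  rw [Fintype.sum_prod_type]
  rw [Finset.sum_eq_single (πh 0 Fin.elim0) (by intro b _ hb; simp [hb]) (by simp)]
  have hin : ∀ s : Fin 9, (∑ y : Fin 3 × Fin 9,
      ((Pstar 0 (πh 0 Fin.elim0) s * if πh 0 Fin.elim0 = πh 0 Fin.elim0 then 1 else 0) *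
      (Pstar s y.1 y.2 * if y.1 = πh 1 (fun _ => (πh 0 Fin.elim0, s)) then 1 else 0)) *
        f ![(πh 0 Fin.elim0, s), y]) =
      Pstar 0 (πh 0 Fin.elim0) s * ∑ s', Pstar s (πh 1 (fun _ => (πh 0 Fin.elim0, s))) s' *
        f ![(πh 0 Fin.elim0, s), (πh 1 (fun _ => (πh 0 Fin.elim0, s)), s')] := by
    intro s
    rw [Fintype.sum_prod_type]
    rw [Finset.sum_eq_single (πh 1 (fun _ => (πh 0 Fin.elim0, s)))
      (by intro b _ hb; simp [hb]) (by simp)]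
    rw [Finset.mul_sum]
    apply Finset.sum_congr rfl
    intro s' _
    simp only [if_true]
    ring
  refine (Finset.sum_congr rfl (fun s _ => ?_)).trans
    ((Finset.sum_congr rfl (fun s _ => hin s)).trans ?_)
  · apply Finset.sum_congr rfl
    intro y _
    congr
  · have h2 : ∀ g : Fin 9 → ℝ, ∀ a, ∑ s', Pstar 2 a s' * g s' = g 8 := by
      intro g a; simp [Pstar]
    have h0 : ∀ g : Fin 9 → ℝ, ∀ a, ∑ s', Pstar 0 a s' * g s' = 1/2 * g 1 + 1/2 * g 2 := by
      intro g a
      rw [sum_nine]; simp [Pstar]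
    rw [h0]
    have := h2 (fun s' => f ![(πh 0 Fin.elim0, 2), (actTwo πh, s')]) (actTwo πh)
    simp only [actOne, actTwo] at this ⊢
    rw [this]

lemma ret_two (x y : Fin 3 × Fin 9) :
    ret Rstar 1 0 ![x, y] = Rstar x.2 y.1 y.2 := by
  unfold ret
  rw [Fin.sum_univ_two]
  simp [stAt, Rstar]

/-- Values of the static problem, depending on the action at `s₁`. -/
def valSet (a : Fin 3) (α : ℝ) : Set ℝ :=
  {x | ∃ ξ : Fin 9 → ℝ, (∀ s, 0 ≤ ξ s ∧ ξ s ≤ 1 / α) ∧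
    1 / 2 * (∑ s', Pstar 1 a s' * ξ s') + 1 / 2 * ξ 8 = 1 ∧
    x = 1 / 2 * (∑ s', Pstar 1 a s' * (ξ s' * Rstar 1 a s')) + 1 / 2 * (ξ 8 * 200)}

lemma static_eq (πh : HPolicy (Fin 9) (Fin 3)) (α : ℝ) :
    staticCVaR Pstar Rstar 1 0 2 πh α = sInf (valSet (actOne πh) α) := by
  unfold staticCVaR valSet RiskEnv
  congr 1
  ext x
  simp only [Set.mem_ofPred_eq, mul_assoc]
  simp only [sum_hist, ret_two]
  have hR : ∀ a, Rstar 2 a 8 = 200 := by intro a; simp [Rstar]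
  have hP : ∀ a, Pstar 1 a 8 = 0 := by
    intro a; fin_cases a <;> simp [Pstar, Fin.ext_iff]
  simp only [hR]
  constructor
  · rintro ⟨ξ, ⟨h1, h2⟩, h3⟩
    refine ⟨fun s => if s = 8 then ξ ![(πh 0 Fin.elim0, 2), (actTwo πh, 8)] else
      ξ ![(πh 0 Fin.elim0, 1), (actOne πh, s)], ?_, ?_, ?_⟩
    · intro s
      dsimp only
      split_ifs <;> exact h1 _
    · refine Eq.trans ?_ h2
      simp only [if_true]
      congr 2
      apply Finset.sum_congr rfl
      intro s _
      by_cases hs : s = 8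
      · subst hs; simp [hP]
      · simp [hs]
    · rw [h3]
      simp only [if_true]
      congr 2
      apply Finset.sum_congr rfl
      intro s _
      by_cases hs : s = 8
      · subst hs; simp [hP]
      · simp [hs]
  · rintro ⟨ξ, h1, h2, h3⟩
    refine ⟨fun H => ξ (H 1).2, ⟨fun H => h1 _, ?_⟩, ?_⟩
    · simpa using h2
    · simpa using h3

lemma sumP0 (g : Fin 9 → ℝ) : ∑ s', Pstar 1 0 s' * g s' = 3 / 4 * g 3 + 1 / 4 * g 4 := by
  rw [sum_nine]; simp [Pstar]
lemma sumP1 (g : Fin 9 → ℝ) : ∑ s', Pstar 1 1 s' * g s' = g 5 := by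
  rw [sum_nine]; simp [Pstar]
lemma sumP2 (g : Fin 9 → ℝ) : ∑ s', Pstar 1 2 s' * g s' = 1 / 2 * g 6 + 1 / 2 * g 7 := by
  rw [sum_nine]; simp [Pstar]
lemma sumPs0 (g : Fin 9 → ℝ) (a : Fin 3) :
    ∑ s', Pstar 0 a s' * g s' = 1 / 2 * g 1 + 1 / 2 * g 2 := by
  rw [sum_nine]; simp [Pstar]
lemma sumPs2 (g : Fin 9 → ℝ) (a : Fin 3) : ∑ s', Pstar 2 a s' * g s' = g 8 := by
  simp [Pstar]

lemma R103 : Rstar 1 0 3 = 600 := by simp [Rstar]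
lemma R104 : Rstar 1 0 4 = -600 := by simp [Rstar]
lemma R115 : Rstar 1 1 5 = 0 := by simp [Rstar]
lemma R126 : Rstar 1 2 6 = -100 := by simp [Rstar]
lemma R127 : Rstar 1 2 7 = 400 := by simp [Rstar]

lemma valSet_bdd (a : Fin 3) (α : ℝ) : ∀ x ∈ valSet a α, -600 ≤ x := by
  rintro x ⟨ξ, h1, h2, h3⟩
  have a3 := (h1 3).1
  have a4 := (h1 4).1
  have a5 := (h1 5).1
  have a6 := (h1 6).1
  have a7 := (h1 7).1
  have a8 := (h1 8).1
  fin_cases a <;>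
    simp only [Fin.zero_eta, Fin.mk_one, Fin.reduceFinMk, sumP0, sumP1, sumP2, R103, R104,
      R115, R126, R127] at h2 h3 <;> linarith

lemma valSet_bddBelow (a : Fin 3) (α : ℝ) : BddBelow (valSet a α) :=
  ⟨-600, valSet_bdd a α⟩

lemma bddAbove_static (α : ℝ) : BddAbove {x : ℝ | ∃ πh : HPolicy (Fin 9) (Fin 3),
          x = staticCVaR Pstar Rstar 1 0 2 πh α} := by
  have : {x : ℝ | ∃ πh : HPolicy (Fin 9) (Fin 3),
          x = staticCVaR Pstar Rstar 1 0 2 πh α} ⊆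
      Set.range (fun a : Fin 3 => sInf (valSet a α)) := by
    rintro x ⟨πh, rfl⟩
    exact ⟨actOne πh, (static_eq πh α).symm⟩
  exact (Set.finite_range _).bddAbove.mono this

/-- If `πh` is suboptimal compared with the constant policy `b`, then it is beaten. -/
lemma lt_sSup_of (πh : HPolicy (Fin 9) (Fin 3)) (α : ℝ) (b : Fin 3)
    (h : sInf (valSet (actOne πh) α) < sInf (valSet b α)) :
    staticCVaR Pstar Rstar 1 0 2 πh α < sSup {x : ℝ | ∃ πh : HPolicy (Fin 9) (Fin 3),
          x = staticCVaR Pstar Rstar 1 0 2 πh α} := by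
  rw [static_eq]
  refine h.trans_le (le_csSup (bddAbove_static α) ⟨piConst b, ?_⟩)
  rw [static_eq]
  rfl

/-- Explicit perturbations on the states `s₃,…,s₈`. -/
def mkXi (x3 x4 x5 x6 x7 x8 : ℝ) : Fin 9 → ℝ := ![0, 0, 0, x3, x4, x5, x6, x7, x8]

lemma mkXi_env (x3 x4 x5 x6 x7 x8 c : ℝ) (h3 : 0 ≤ x3 ∧ x3 ≤ c) (h4 : 0 ≤ x4 ∧ x4 ≤ c)
    (h5 : 0 ≤ x5 ∧ x5 ≤ c) (h6 : 0 ≤ x6 ∧ x6 ≤ c) (h7 : 0 ≤ x7 ∧ x7 ≤ c)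
    (h8 : 0 ≤ x8 ∧ x8 ≤ c) : ∀ s, 0 ≤ mkXi x3 x4 x5 x6 x7 x8 s ∧
      mkXi x3 x4 x5 x6 x7 x8 s ≤ c := by
  have h0 : (0:ℝ) ≤ 0 ∧ 0 ≤ c := ⟨le_rfl, h3.1.trans h3.2⟩
  intro s
  fin_cases s
  exacts [h0, h0, h0, h3, h4, h5, h6, h7, h8]

lemma mk3 (x3 x4 x5 x6 x7 x8 : ℝ) : mkXi x3 x4 x5 x6 x7 x8 3 = x3 := rfl
lemma mk4 (x3 x4 x5 x6 x7 x8 : ℝ) : mkXi x3 x4 x5 x6 x7 x8 4 = x4 := rfl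
lemma mk5 (x3 x4 x5 x6 x7 x8 : ℝ) : mkXi x3 x4 x5 x6 x7 x8 5 = x5 := rfl
lemma mk6 (x3 x4 x5 x6 x7 x8 : ℝ) : mkXi x3 x4 x5 x6 x7 x8 6 = x6 := rfl
lemma mk7 (x3 x4 x5 x6 x7 x8 : ℝ) : mkXi x3 x4 x5 x6 x7 x8 7 = x7 := rfl
lemma mk8 (x3 x4 x5 x6 x7 x8 : ℝ) : mkXi x3 x4 x5 x6 x7 x8 8 = x8 := rfl

lemma valSet_ne (a : Fin 3) (α : ℝ) (h0 : 0 < α) (h1 : α ≤ 1) : (valSet a α).Nonempty := by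
  have : 1 ≤ 1 / α := by rw [le_div_iff₀ h0]; linarith
  refine ⟨_, fun _ => 1, fun s => ⟨zero_le_one, this⟩, ?_, rfl⟩
  fin_cases a <;> simp only [Fin.zero_eta, Fin.mk_one, Fin.reduceFinMk, sumP0, sumP1, sumP2] <;>
    norm_num

/-- Low risk levels: only `a₂` is optimal. -/
lemma low_opt (a : Fin 3) (α : ℝ) (h0 : 1 / 5 ≤ α) (h1 : α ≤ 1 / 4) (ha : a ≠ 1) :
    sInf (valSet a α) < sInf (valSet 1 α) := by
  have hpos : 0 < α := by linarith
  have hlow : 0 ≤ sInf (valSet 1 α) := by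
    apply le_csInf (valSet_ne 1 α hpos (by linarith))
    rintro x ⟨ξ, h1, h2, h3⟩
    have a8 := (h1 8).1
    rw [sumP1, R115] at h3
    linarith
  have hi4 : 4 ≤ 1 / α := by rw [le_div_iff₀ hpos]; linarith
  have hi5 : 1 / α ≤ 5 := by rw [div_le_iff₀ hpos]; linarith
  refine lt_of_lt_of_le ?_ hlow
  have ht : a = 0 ∨ a = 2 := by fin_cases a <;> simp_all
  rcases ht with rfl | rfl
  · refine lt_of_le_of_lt (csInf_le (valSet_bddBelow _ _) ⟨mkXi 0 (1 / α) 0 0 0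
      (2 - 1 / 4 * (1 / α)), ?_, ?_, rfl⟩) ?_
    · apply mkXi_env <;> constructor <;> linarith
    · rw [sumP0, mk3, mk4, mk8]; ring
    · rw [sumP0, mk3, mk4, mk8, R103, R104]; linarith
  · refine lt_of_le_of_lt (csInf_le (valSet_bddBelow _ _) ⟨mkXi 0 0 0 4 0 0, ?_, ?_, rfl⟩) ?_
    · apply mkXi_env <;> constructor <;> linarith
    · rw [sumP2, mk6, mk7, mk8]; norm_num
    · rw [sumP2, mk6, mk7, mk8, R126, R127]; norm_num

/-- Risk level `7/10`: only `a₁` is optimal. -/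
lemma high_opt (a : Fin 3) (ha : a ≠ 0) :
    sInf (valSet a (7 / 10)) < sInf (valSet 0 (7 / 10)) := by
  have hlow : 100 ≤ sInf (valSet 0 (7 / 10)) := by
    apply le_csInf (valSet_ne 0 _ (by norm_num) (by norm_num))
    rintro x ⟨ξ, h1, h2, h3⟩
    have a8 := (h1 8).2
    have a4 := (h1 4).2
    rw [sumP0] at h2
    rw [sumP0, R103, R104] at h3
    norm_num at a8 a4
    linarith
  refine lt_of_lt_of_le ?_ hlow
  have ht : a = 1 ∨ a = 2 := by fin_cases a <;> simp_all
  rcases ht with rfl | rfl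
  · refine lt_of_le_of_lt (csInf_le (valSet_bddBelow _ _) ⟨mkXi 0 0 (10 / 7) 0 0 (4 / 7),
      ?_, ?_, rfl⟩) ?_
    · apply mkXi_env <;> constructor <;> norm_num
    · rw [sumP1, mk5, mk8]; norm_num
    · rw [sumP1, mk5, mk8, R115]; norm_num
  · refine lt_of_le_of_lt (csInf_le (valSet_bddBelow _ _) ⟨mkXi 0 0 0 (10 / 7) 0 (9 / 7),
      ?_, ?_, rfl⟩) ?_
    · apply mkXi_env <;> constructor <;> norm_num
    · rw [sumP2, mk6, mk7, mk8]; norm_num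
    · rw [sumP2, mk6, mk7, mk8, R126, R127]; norm_num

section DP
variable (πt : Fin 9 → ℝ → Fin 3)

/-- One-step values at `s₁`. -/
def stepSet (a : Fin 3) (y : ℝ) : Set ℝ :=
  {x | ∃ ξ : Fin 9 → ℝ, ((∀ s, 0 ≤ ξ s ∧ ξ s ≤ 1 / y) ∧ ∑ s', Pstar 1 a s' * ξ s' = 1) ∧
    x = ∑ s', Pstar 1 a s' * (ξ s' * Rstar 1 a s')}

lemma Vdp_one (y : ℝ) : Vdp Pstar Rstar 1 πt 1 1 y = sInf (stepSet (πt 1 y) y) := by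
  unfold stepSet
  simp only [Vdp, RiskEnv, mul_assoc, mul_zero, add_zero]

lemma Vdp_two (y : ℝ) (h0 : 0 < y) (h1 : y ≤ 1) : Vdp Pstar Rstar 1 πt 1 2 y = 200 := by
  have : 1 ≤ 1 / y := by rw [le_div_iff₀ h0]; linarith
  have hR : ∀ a, Rstar 2 a 8 = 200 := by intro a; simp [Rstar]
  simp only [Vdp, RiskEnv, mul_assoc, mul_zero, add_zero, sumPs2, hR]
  have : {x : ℝ | ∃ ξ : Fin 9 → ℝ, ((∀ s, 0 ≤ ξ s ∧ ξ s ≤ 1 / y) ∧ ξ 8 = 1) ∧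
      x = ξ 8 * 200} = {200} := by
    ext x
    simp only [Set.mem_ofPred_eq, Set.mem_singleton_iff]
    constructor
    · rintro ⟨ξ, ⟨_, h⟩, rfl⟩
      rw [h, one_mul]
    · rintro rfl
      exact ⟨fun _ => 1, ⟨fun _ => ⟨zero_le_one, this⟩, rfl⟩, by norm_num⟩
  rw [this, csInf_singleton]

lemma stepSet_bdd (a : Fin 3) (y : ℝ) : ∀ x ∈ stepSet a y, -600 ≤ x := by
  rintro x ⟨ξ, ⟨h1, h2⟩, h3⟩
  have a3 := (h1 3).1
  have a4 := (h1 4).1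
  have a5 := (h1 5).1
  have a6 := (h1 6).1
  have a7 := (h1 7).1
  fin_cases a <;>
    simp only [Fin.zero_eta, Fin.mk_one, Fin.reduceFinMk, sumP0, sumP1, sumP2, R103, R104,
      R115, R126, R127] at h2 h3 <;> linarith

lemma stepSet_ne (a : Fin 3) (α : ℝ) (h0 : 0 < α) (h1 : α ≤ 1) : (stepSet a α).Nonempty := by
  have : 1 ≤ 1 / α := by rw [le_div_iff₀ h0]; linarith
  refine ⟨_, fun _ => 1, ⟨fun s => ⟨zero_le_one, this⟩, ?_⟩, rfl⟩
  fin_cases a <;> simp only [Fin.zero_eta, Fin.mk_one, Fin.reduceFinMk, sumP0, sumP1, sumP2] <;>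
    norm_num

lemma V1_lower (y : ℝ) : -600 ≤ Vdp Pstar Rstar 1 πt 1 1 y := by
  rw [Vdp_one]
  rcases (stepSet (πt 1 y) y).eq_empty_or_nonempty with h | h
  · rw [h, Real.sInf_empty]; norm_num
  · exact le_csInf h (stepSet_bdd _ _)

lemma V2_lower (y : ℝ) (h0 : 0 ≤ y) (h1 : y ≤ 1) : 0 ≤ Vdp Pstar Rstar 1 πt 1 2 y := by
  rcases h0.eq_or_lt with rfl | h
  · simp only [Vdp, RiskEnv]
    have : {x : ℝ | ∃ ξ : Fin 9 → ℝ, ((∀ s, 0 ≤ ξ s ∧ ξ s ≤ 1 / (0:ℝ)) ∧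
        ∑ s', Pstar 2 (πt 2 0) s' * ξ s' = 1) ∧
        x = ∑ s', Pstar 2 (πt 2 0) s' * ξ s' * (Rstar 2 (πt 2 0) s' + 1 * 0)} = ∅ := by
      rw [Set.eq_empty_iff_forall_notMem]
      rintro x ⟨ξ, ⟨h1, h2⟩, -⟩
      rw [sumPs2] at h2
      have := (h1 8).2
      simp only [div_zero] at this
      linarith
    rw [this, Real.sInf_empty]
  · rw [Vdp_two πt y h h1]; norm_num

lemma V1_a2 (y : ℝ) (h0 : 0 < y) (h1 : y ≤ 1) (h : πt 1 y = 1) :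
    Vdp Pstar Rstar 1 πt 1 1 y = 0 := by
  rw [Vdp_one, h]
  have hs : ∀ x ∈ stepSet 1 y, x = 0 := by
    rintro x ⟨ξ, _, h3⟩
    rw [sumP1, R115] at h3
    linarith
  have : stepSet 1 y = {0} :=
    Set.eq_singleton_iff_nonempty_unique_mem.2 ⟨stepSet_ne 1 y h0 h1, hs⟩
  rw [this, csInf_singleton]

lemma V1_a1 (y : ℝ) (h0 : 0 < y) (h1 : y ≤ 1) (h : πt 1 y = 0) :
    600 - 300 * (1 / y) ≤ Vdp Pstar Rstar 1 πt 1 1 y := by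
  rw [Vdp_one, h]
  apply le_csInf (stepSet_ne _ y h0 h1)
  rintro x ⟨ξ, ⟨h1, h2⟩, h3⟩
  rw [sumP0] at h2
  rw [sumP0, R103, R104] at h3
  have := (h1 4).2
  linarith

lemma V1_nonpos (y : ℝ) (h0 : 2 / 5 ≤ y) (h1 : y ≤ 1 / 2) :
    Vdp Pstar Rstar 1 πt 1 1 y ≤ 0 := by
  have hy : 0 < y := by linarith
  have hi4 : 2 ≤ 1 / y := by rw [le_div_iff₀ hy]; linarith
  have hi5 : 1 / y ≤ 5 / 2 := by rw [div_le_iff₀ hy]; linarith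
  rw [Vdp_one]
  generalize πt 1 y = a
  have hb : BddBelow (stepSet a y) := ⟨-600, stepSet_bdd a y⟩
  have ht : a = 0 ∨ a = 1 ∨ a = 2 := by fin_cases a <;> simp
  rcases ht with rfl | rfl | rfl
  · refine (csInf_le hb ⟨mkXi (4 / 3 - 1 / 3 * (1 / y)) (1 / y) 0 0 0 0, ⟨?_, ?_⟩, rfl⟩).trans ?_
    · apply mkXi_env <;> constructor <;> linarith
    · rw [sumP0, mk3, mk4]; ring
    · rw [sumP0, mk3, mk4, R103, R104]; linarith
  · refine (csInf_le hb ⟨mkXi 0 0 1 0 0 0, ⟨?_, ?_⟩, rfl⟩).trans ?_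
    · apply mkXi_env <;> constructor <;> linarith
    · rw [sumP1, mk5]
    · rw [sumP1, mk5, R115]; norm_num
  · refine (csInf_le hb ⟨mkXi 0 0 0 2 0 0, ⟨?_, ?_⟩, rfl⟩).trans ?_
    · apply mkXi_env <;> constructor <;> linarith
    · rw [sumP2, mk6, mk7]; norm_num
    · rw [sumP2, mk6, mk7, R126, R127]; norm_num

/-- The minimality of `ξ̃⋆` at the initial state, in explicit form. -/
lemma init_min (ξt : Fin 9 → ℝ → Fin 3 → Fin 9 → ℝ)
    (hvalid : ValidFamily Pstar ξt) (hmin : AttainsMin Pstar Rstar 1 πt ξt)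
    (α : ℝ) (h0 : 0 < α) (h1 : α ≤ 1) :
    ∃ x1 x2 : ℝ, x1 = ξt 0 α (πt 0 α) 1 ∧ 0 ≤ x1 ∧ 0 ≤ x2 ∧ α * x1 ≤ 1 ∧ α * x2 ≤ 1 ∧
      x1 + x2 = 2 ∧ ∀ z1 z2 : ℝ, 0 ≤ z1 → 0 ≤ z2 → α * z1 ≤ 1 → α * z2 ≤ 1 → z1 + z2 = 2 →
        x1 * Vdp Pstar Rstar 1 πt 1 1 (α * x1) + x2 * 200 ≤
        z1 * Vdp Pstar Rstar 1 πt 1 1 (α * z1) + z2 * 200 := by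
  obtain ⟨e1, e2⟩ := hvalid.1 0 α (πt 0 α) h0 h1
  have hm := hmin 1 0 α h0 h1
  have hR : ∀ a s, Rstar 0 a s = 0 := by intro a s; simp [Rstar]
  have mul_le : ∀ z : ℝ, z ≤ 1 / α ↔ α * z ≤ 1 := by
    intro z; rw [le_div_iff₀ h0, mul_comm]
  have v2 : ∀ z : ℝ, 0 ≤ z → α * z ≤ 1 →
      z * Vdp Pstar Rstar 1 πt 1 2 (α * z) = z * 200 := by
    intro z hz hz1
    rcases hz.eq_or_lt with rfl | hz
    · simp
    · rw [Vdp_two πt _ (by positivity) hz1]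
  rw [sumPs0] at e2
  have b1 := e1 1
  have b2 := e1 2
  rw [mul_le] at b1 b2
  refine ⟨_, ξt 0 α (πt 0 α) 2, rfl, b1.1, b2.1, b1.2, b2.2, by linarith, ?_⟩
  intro z1 z2 hz1 hz2 hz1' hz2' hz
  simp only [mul_assoc, sumPs0, hR, zero_add, one_mul] at hm
  rw [v2 _ b2.1 b2.2] at hm
  have hle : Vdp Pstar Rstar 1 πt (1 + 1) 0 α ≤
      1 / 2 * (z1 * Vdp Pstar Rstar 1 πt 1 1 (α * z1)) + 1 / 2 * (z2 * 200) := by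
    rw [Vdp]
    simp only [RiskEnv, mul_assoc, sumPs0, hR, zero_add, one_mul]
    apply csInf_le
    · refine ⟨-600, ?_⟩
      rintro x ⟨ξ, ⟨c1, c2⟩, rfl⟩
      have d1 := c1 1
      have d2 := c1 2
      rw [mul_le] at d1 d2
      rw [v2 _ d2.1 d2.2]
      have := mul_le_mul_of_nonneg_left (V1_lower πt (α * ξ 1)) d1.1
      linarith [d1.1, d2.1]
    · refine ⟨![0, z1, z2, 0, 0, 0, 0, 0, 0], ⟨?_, ?_⟩, ?_⟩
      · have hn : (0:ℝ) ≤ 0 ∧ (0:ℝ) ≤ 1 / α := ⟨le_rfl, by positivity⟩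
        intro s
        fin_cases s
        exacts [hn, ⟨hz1, (mul_le _).2 hz1'⟩, ⟨hz2, (mul_le _).2 hz2'⟩, hn, hn, hn, hn, hn, hn]
      · show 1 / 2 * z1 + 1 / 2 * z2 = 1
        linarith
      · show _ = 1 / 2 * (z1 * Vdp Pstar Rstar 1 πt 1 1 (α * z1)) +
          1 / 2 * (z2 * Vdp Pstar Rstar 1 πt 1 2 (α * z2))
        rw [v2 _ hz2 hz2']
  linarith

end DP

lemma actOne_induced (πt : Fin 9 → ℝ → Fin 3) (ξt : Fin 9 → ℝ → Fin 3 → Fin 9 → ℝ) (α : ℝ) :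
    actOne (inducedPolicy πt ξt 0 α) = πt 1 (α * ξt 0 α (πt 0 α) 1) := by
  simp [actOne, inducedPolicy, stAt, riskAt]

/-- impossibility of uniform optimality:
in the counterexample MDP `M★` (horizon `T = 2`, `γ = 1`, initial state `s₀`), no
risk-dependent policy is uniformly optimal: for every risk-dependent policy
`π̃ : S × [0,1] → A` and every choice of minimizing family `ξ̃⋆` defining the induced
policies `π̃_h^α`, there exists an initial risk level `α ∈ (0,1]` such that
`CVaR_α[Z^{π̃_h^α}] < max_{π_h} CVaR_α[Z^{π_h}]`. -/
theorem stmt11 (πt : Fin 9 → ℝ → Fin 3) (ξtstar : Fin 9 → ℝ → Fin 3 → Fin 9 → ℝ)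
    (hvalid : ValidFamily Pstar ξtstar) (hmin : AttainsMin Pstar Rstar 1 πt ξtstar) :
    ∃ α : ℝ, 0 < α ∧ α ≤ 1 ∧
      staticCVaR Pstar Rstar 1 0 2 (inducedPolicy πt ξtstar 0 α) α <
        sSup {x : ℝ | ∃ πh : HPolicy (Fin 9) (Fin 3),
          x = staticCVaR Pstar Rstar 1 0 2 πh α} := by
  by_contra hcon
  push Not at hcon
  have low : ∀ y : ℝ, 2 / 5 ≤ y → y ≤ 1 / 2 → πt 1 y = 1 := by
    intro y hy0 hy1
    have hc := hcon (y / 2) (by linarith) (by linarith)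
    have hact : πt 1 (y / 2 * ξtstar 0 (y / 2) (πt 0 (y / 2)) 1) = 1 := by
      by_contra hne
      rw [← actOne_induced πt ξtstar (y / 2)] at hne
      exact absurd (lt_sSup_of _ _ 1 (low_opt _ _ (by linarith) (by linarith) hne))
        (not_lt.2 hc)
    obtain ⟨x1, x2, hx, p1, p2, q1, q2, hs, hm⟩ :=
      init_min πt ξtstar hvalid hmin (y / 2) (by linarith) (by linarith)
    rw [← hx] at hact
    have h := hm 2 0 (by norm_num) le_rfl (by linarith) (by linarith) (by norm_num)
    have hv : x1 * Vdp Pstar Rstar 1 πt 1 1 (y / 2 * x1) = 0 := by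
      rcases p1.eq_or_lt with h0 | h0
      · rw [← h0, zero_mul]
      · rw [V1_a2 πt _ (mul_pos (by linarith) h0) q1 hact, mul_zero]
    have e : y / 2 * 2 = y := by ring
    have hn := V1_nonpos πt y hy0 hy1
    rw [hv, e] at h
    have hx1 : x1 = 2 := by linarith
    rw [hx1, e] at hact
    exact hact
  have hc := hcon (7 / 10) (by norm_num) (by norm_num)
  have hact : πt 1 (7 / 10 * ξtstar 0 (7 / 10) (πt 0 (7 / 10)) 1) = 0 := by
    by_contra hne
    rw [← actOne_induced πt ξtstar (7 / 10)] at hne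
    exact absurd (lt_sSup_of _ _ 0 (high_opt _ hne)) (not_lt.2 hc)
  obtain ⟨x1, x2, hx, p1, p2, q1, q2, hs, hm⟩ :=
    init_min πt ξtstar hvalid hmin (7 / 10) (by norm_num) (by norm_num)
  rw [← hx] at hact
  have h := hm (5 / 7) (9 / 7) (by norm_num) (by norm_num) (by norm_num) (by norm_num)
    (by norm_num)
  have e : (7 / 10 : ℝ) * (5 / 7) = 1 / 2 := by norm_num
  rw [e, V1_a2 πt _ (by norm_num) (by norm_num) (low _ (by norm_num) le_rfl)] at h
  have hy0 : 2 / 5 ≤ 7 / 10 * x1 := by linarith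
  have hx0 : 0 < x1 := by linarith
  have hV := mul_le_mul_of_nonneg_left (V1_a1 πt _ (by linarith) q1 hact) p1
  have e2 : x1 * (600 - 300 * (1 / (7 / 10 * x1))) = 600 * x1 - 3000 / 7 := by
    field_simp
    ring
  rw [e2] at hV
  have := low (7 / 10 * x1) hy0 (by linarith)
  rw [this] at hact
  exact absurd hact (by decide)
end

section
/- Optimal-policy regions in the counterexample: in M★ with horizon T = 2, where π^{(i)} denotes the history-dependent policy selecting action a_i at s₁ (i = 1,2,3): for every α ∈ (0, 3/8), CVaR_α[Z^{π^{(2)}}] > CVaR_α[Z^{π^{(1)}}] and CVaR_α[Z^{π^{(2)}}] > CVaR_α[Z^{π^{(3)}}]; for every α ∈ (3/8, 11/16), CVaR_α[Z^{π^{(3)}}] strictly exceeds the CVaR of the other two policies; and for every α ∈ (11/16, 1], CVaR_α[Z^{π^{(1)}}] strictly exceeds the CVaR of the other two policies. -/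
open Finset

section CVaRDefs

attribute [local instance] Classical.propDecidable

variable {S A : Type*}

end CVaRDefs

lemma sum_hist_s12 (i : Fin 3) (f : (Fin 2 → Fin 3 × Fin 9) → ℝ) :
    ∑ H : Fin 2 → Fin 3 × Fin 9, histProb Pstar 0 (piConst i) H * f H =
      ∑ s1 : Fin 9, ∑ s2 : Fin 9, Pstar 0 i s1 * Pstar s1 i s2 * f ![(i, s1), (i, s2)] := by
  rw [← (piFinTwoEquiv (fun _ => Fin 3 × Fin 9)).symm.sum_comp]
  simp only [Fintype.sum_prod_type, histProb, Fin.prod_univ_two, piConst]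
  have key : ∀ (a : Fin 3) (s1 : Fin 9) (b : Fin 3) (s2 : Fin 9),
      (piFinTwoEquiv (fun _ => Fin 3 × Fin 9)).symm ((a, s1), (b, s2)) = ![(a, s1), (b, s2)] := by
    intro a s1 b s2
    funext k
    fin_cases k <;> rfl
  simp only [key]
  rw [Finset.sum_eq_single i]
  · refine Finset.sum_congr rfl fun s1 _ => ?_
    rw [Finset.sum_eq_single i]
    · refine Finset.sum_congr rfl fun s2 _ => ?_
      simp [stAt]
    · intro b _ hb
      simp [hb]
    · simp
  · intro b _ hb
    simp [hb]
  · simp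

lemma sum0 (f : (Fin 2 → Fin 3 × Fin 9) → ℝ) :
    ∑ H : Fin 2 → Fin 3 × Fin 9, histProb Pstar 0 (piConst 0) H * f H =
      1 / 8 * f ![(0, 1), (0, 4)] + 1 / 2 * f ![(0, 2), (0, 8)] + 3 / 8 * f ![(0, 1), (0, 3)] := by
  rw [sum_hist_s12]
  simp [Fin.sum_univ_succ, Pstar]
  ring

lemma sum1 (f : (Fin 2 → Fin 3 × Fin 9) → ℝ) :
    ∑ H : Fin 2 → Fin 3 × Fin 9, histProb Pstar 0 (piConst 1) H * f H =
      1 / 2 * f ![(1, 1), (1, 5)] + 1 / 2 * f ![(1, 2), (1, 8)] + 0 * f ![(1, 1), (1, 6)] := by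
  rw [sum_hist_s12]
  simp [Fin.sum_univ_succ, Pstar]

lemma sum2 (f : (Fin 2 → Fin 3 × Fin 9) → ℝ) :
    ∑ H : Fin 2 → Fin 3 × Fin 9, histProb Pstar 0 (piConst 2) H * f H =
      1 / 4 * f ![(2, 1), (2, 6)] + 1 / 2 * f ![(2, 2), (2, 8)] + 1 / 4 * f ![(2, 1), (2, 7)] := by
  rw [sum_hist_s12]
  simp [Fin.sum_univ_succ, Pstar]
  ring

/-- Characterisation of `α · CVaR_α` of `π^{(i)}` through a three-atom linear program. -/
def IsLP (i : Fin 3) (p q r x y z α : ℝ) : Prop :=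
    (∀ U V W : ℝ, 0 ≤ U → U ≤ 1 → 0 ≤ V → V ≤ 1 → 0 ≤ W → W ≤ 1 →
      p * U + q * V + r * W = α →
      α * staticCVaR Pstar Rstar 1 0 2 (piConst i) α ≤ p * U * x + q * V * y + r * W * z) ∧
    (∀ c : ℝ, (∀ U V W : ℝ, 0 ≤ U → U ≤ 1 → 0 ≤ V → V ≤ 1 → 0 ≤ W → W ≤ 1 →
      p * U + q * V + r * W = α → c ≤ p * U * x + q * V * y + r * W * z) →
      c ≤ α * staticCVaR Pstar Rstar 1 0 2 (piConst i) α)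

/-- CVaR of a policy whose history law is carried by three atoms. -/
lemma cvar_three (i : Fin 3) (p q r x y z : ℝ) (h1 h2 h3 : Fin 2 → Fin 3 × Fin 9)
    (h12 : h1 ≠ h2) (h13 : h1 ≠ h3) (h23 : h2 ≠ h3)
    (hp : 0 ≤ p) (hq : 0 ≤ q) (hr : 0 ≤ r) (hpqr : p + q + r = 1)
    (hsum : ∀ f : (Fin 2 → Fin 3 × Fin 9) → ℝ,
      ∑ H : Fin 2 → Fin 3 × Fin 9, histProb Pstar 0 (piConst i) H * f H =
        p * f h1 + q * f h2 + r * f h3)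
    (hx : ret Rstar 1 0 h1 = x) (hy : ret Rstar 1 0 h2 = y) (hz : ret Rstar 1 0 h3 = z)
    (α : ℝ) (h0 : 0 < α) (hα : α ≤ 1) :
    IsLP i p q r x y z α := by
  have lower : ∀ c : ℝ, (∀ U V W : ℝ, 0 ≤ U → U ≤ 1 → 0 ≤ V → V ≤ 1 → 0 ≤ W → W ≤ 1 →
      p * U + q * V + r * W = α → c ≤ p * U * x + q * V * y + r * W * z) →
      c / α ∈ lowerBounds {x | ∃ ξ : (Fin 2 → Fin 3 × Fin 9) → ℝ,
        RiskEnv α (fun H => histProb Pstar 0 (piConst i) H) ξ ∧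
        x = ∑ H, histProb Pstar 0 (piConst i) H * ξ H * ret Rstar 1 0 H} := by
    rintro c hc _ ⟨ξ, ⟨hb, h1s⟩, rfl⟩
    simp only [mul_assoc] at h1s ⊢
    rw [hsum] at h1s
    rw [hsum (fun H => ξ H * ret Rstar 1 0 H), hx, hy, hz, div_le_iff₀ h0]
    have e : ∀ H, 0 ≤ α * ξ H ∧ α * ξ H ≤ 1 := fun H =>
      ⟨mul_nonneg h0.le (hb H).1, by
        have := (le_div_iff₀ h0).1 (hb H).2
        linarith⟩
    have := hc (α * ξ h1) (α * ξ h2) (α * ξ h3) (e h1).1 (e h1).2 (e h2).1 (e h2).2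
      (e h3).1 (e h3).2 (by linear_combination α * h1s)
    linarith
  constructor
  · intro U V W hU hU1 hV hV1 hW hW1 hs
    rw [mul_comm, ← le_div_iff₀ h0]
    refine csInf_le ⟨_, lower (-(|x| + |y| + |z|)) ?_⟩ ?_
    · intro U V W hU hU1 hV hV1 hW hW1 _
      have b : ∀ p U x : ℝ, 0 ≤ p → p ≤ 1 → 0 ≤ U → U ≤ 1 → -|x| ≤ p * U * x := by
        intro p U x hp hp1 hU hU1
        have h : |p * U * x| ≤ |x| := by
          rw [abs_mul, abs_of_nonneg (mul_nonneg hp hU)]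
          exact mul_le_of_le_one_left (abs_nonneg x) (mul_le_one₀ hp1 hU hU1)
        exact (abs_le.1 h).1.trans' (by linarith)
      have := b p U x hp (by linarith) hU hU1
      have := b q V y hq (by linarith) hV hV1
      have := b r W z hr (by linarith) hW hW1
      linarith
    · refine ⟨fun H => (if H = h1 then U else if H = h2 then V else if H = h3 then W else 0) / α,
        ⟨fun H => ?_, ?_⟩, ?_⟩
      · constructor
        · refine div_nonneg ?_ h0.le
          split_ifs <;> simp_all
        · refine div_le_div_of_nonneg_right ?_ h0.le
          split_ifs <;> simp_all
      · rw [hsum]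
        simp only [if_true, h12.symm, h13.symm, h23.symm, if_false]
        field_simp
        linarith
      · simp only [mul_assoc]
        rw [hsum (fun H => (if H = h1 then U else if H = h2 then V else if H = h3 then W else 0) / α
          * ret Rstar 1 0 H)]
        simp only [if_true, h12.symm, h13.symm, h23.symm, if_false, hx, hy, hz]
        field_simp
  · intro c hc
    rw [mul_comm, ← div_le_iff₀ h0]
    refine le_csInf ⟨_, fun _ => 1, ⟨fun _ => ⟨zero_le_one, ?_⟩, ?_⟩, rfl⟩ (lower c hc)
    · rw [le_div_iff₀ h0]; linarith
    · rw [hsum]; linarith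

lemma cvar0 (α : ℝ) (h0 : 0 < α) (hα : α ≤ 1) :
    IsLP 0 (1 / 8) (1 / 2) (3 / 8) (-600) 200 600 α :=
  cvar_three 0 (1 / 8) (1 / 2) (3 / 8) (-600) 200 600 _ _ _ (by decide) (by decide) (by decide)
    (by norm_num) (by norm_num) (by norm_num) (by norm_num) sum0
    (by simp [ret, Fin.sum_univ_two, stAt, Rstar])
    (by simp [ret, Fin.sum_univ_two, stAt, Rstar])
    (by simp [ret, Fin.sum_univ_two, stAt, Rstar]) α h0 hα

lemma cvar1 (α : ℝ) (h0 : 0 < α) (hα : α ≤ 1) :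
    IsLP 1 (1 / 2) (1 / 2) 0 0 200 0 α :=
  cvar_three 1 (1 / 2) (1 / 2) 0 0 200 0 _ _ _ (by decide) (by decide) (by decide)
    (by norm_num) (by norm_num) (by norm_num) (by norm_num) sum1
    (by simp [ret, Fin.sum_univ_two, stAt, Rstar])
    (by simp [ret, Fin.sum_univ_two, stAt, Rstar])
    (by simp [ret, Fin.sum_univ_two, stAt, Rstar]) α h0 hα

lemma cvar2 (α : ℝ) (h0 : 0 < α) (hα : α ≤ 1) :
    IsLP 2 (1 / 4) (1 / 2) (1 / 4) (-100) 200 400 α :=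
  cvar_three 2 (1 / 4) (1 / 2) (1 / 4) (-100) 200 400 _ _ _ (by decide) (by decide) (by decide)
    (by norm_num) (by norm_num) (by norm_num) (by norm_num) sum2
    (by simp [ret, Fin.sum_univ_two, stAt, Rstar])
    (by simp [ret, Fin.sum_univ_two, stAt, Rstar])
    (by simp [ret, Fin.sum_univ_two, stAt, Rstar]) α h0 hα

/-- optimal-policy regions in the counterexample:
in `M★` with horizon `T = 2`, where `π^{(i)}` selects `a_i` at `s₁`:
for `α ∈ (0, 3/8)`, `π^{(2)}` has strictly larger static CVaR than `π^{(1)}` and `π^{(3)}`;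
for `α ∈ (3/8, 11/16)`, `π^{(3)}` strictly dominates the other two;
and for `α ∈ (11/16, 1]`, `π^{(1)}` strictly dominates the other two.
(Recall `a₁, a₂, a₃` are encoded as `0, 1, 2`.) -/
theorem stmt12 :
    (∀ α : ℝ, 0 < α → α < 3 / 8 →
      staticCVaR Pstar Rstar 1 0 2 (piConst 0) α <
        staticCVaR Pstar Rstar 1 0 2 (piConst 1) α ∧
      staticCVaR Pstar Rstar 1 0 2 (piConst 2) α <
        staticCVaR Pstar Rstar 1 0 2 (piConst 1) α) ∧
    (∀ α : ℝ, 3 / 8 < α → α < 11 / 16 →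
      staticCVaR Pstar Rstar 1 0 2 (piConst 0) α <
        staticCVaR Pstar Rstar 1 0 2 (piConst 2) α ∧
      staticCVaR Pstar Rstar 1 0 2 (piConst 1) α <
        staticCVaR Pstar Rstar 1 0 2 (piConst 2) α) ∧
    (∀ α : ℝ, 11 / 16 < α → α ≤ 1 →
      staticCVaR Pstar Rstar 1 0 2 (piConst 1) α <
        staticCVaR Pstar Rstar 1 0 2 (piConst 0) α ∧
      staticCVaR Pstar Rstar 1 0 2 (piConst 2) α <
        staticCVaR Pstar Rstar 1 0 2 (piConst 0) α) := by
  refine ⟨fun α h0 hα => ?_, fun α h0' hα => ?_, fun α h0' hα => ?_⟩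
  · have L := (cvar1 α h0 (by linarith)).2 0 (by intros; linarith)
    constructor
    · refine lt_of_mul_lt_mul_left (lt_of_lt_of_le ?_ L) h0.le
      rcases le_total α (1 / 8) with h | h
      · have := (cvar0 α h0 (by linarith)).1 (8 * α) 0 0 (by linarith) (by linarith)
          (by linarith) (by linarith) (by linarith) (by linarith) (by ring)
        linarith
      · have := (cvar0 α h0 (by linarith)).1 1 (2 * α - 1 / 4) 0 (by linarith) (by linarith)
          (by linarith) (by linarith) (by linarith) (by linarith) (by ring)
        linarith
    · refine lt_of_mul_lt_mul_left (lt_of_lt_of_le ?_ L) h0.le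
      rcases le_total α (1 / 4) with h | h
      · have := (cvar2 α h0 (by linarith)).1 (4 * α) 0 0 (by linarith) (by linarith)
          (by linarith) (by linarith) (by linarith) (by linarith) (by ring)
        linarith
      · have := (cvar2 α h0 (by linarith)).1 1 (2 * α - 1 / 2) 0 (by linarith) (by linarith)
          (by linarith) (by linarith) (by linarith) (by linarith) (by ring)
        linarith
  · have h0 : 0 < α := by linarith
    have L := (cvar2 α h0 (by linarith)).2 (200 * α - 75) (by intros; linarith)
    constructor
    · refine lt_of_mul_lt_mul_left (lt_of_lt_of_le ?_ L) h0.le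
      rcases le_total α (5 / 8) with h | h
      · have := (cvar0 α h0 (by linarith)).1 1 (2 * α - 1 / 4) 0 (by linarith) (by linarith)
          (by linarith) (by linarith) (by linarith) (by linarith) (by ring)
        linarith
      · have := (cvar0 α h0 (by linarith)).1 1 1 ((α - 5 / 8) * (8 / 3)) (by linarith)
          (by linarith) (by linarith) (by linarith) (by linarith) (by linarith) (by ring)
        linarith
    · refine lt_of_mul_lt_mul_left (lt_of_lt_of_le ?_ L) h0.le
      rcases le_total α (1 / 2) with h | h
      · have := (cvar1 α h0 (by linarith)).1 (2 * α) 0 0 (by linarith) (by linarith)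
          (by linarith) (by linarith) (by linarith) (by linarith) (by ring)
        linarith
      · have := (cvar1 α h0 (by linarith)).1 1 (2 * α - 1) 0 (by linarith) (by linarith)
          (by linarith) (by linarith) (by linarith) (by linarith) (by ring)
        linarith
  · have h0 : 0 < α := by linarith
    have L := (cvar0 α h0 (by linarith)).2 (600 * α - 350) (by intros; linarith)
    constructor
    · refine lt_of_mul_lt_mul_left (lt_of_lt_of_le ?_ L) h0.le
      have := (cvar1 α h0 (by linarith)).1 1 (2 * α - 1) 0 (by linarith) (by linarith)
          (by linarith) (by linarith) (by linarith) (by linarith) (by ring)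
      linarith
    · refine lt_of_mul_lt_mul_left (lt_of_lt_of_le ?_ L) h0.le
      rcases le_total α (3 / 4) with h | h
      · have := (cvar2 α h0 (by linarith)).1 1 (2 * α - 1 / 2) 0 (by linarith) (by linarith)
          (by linarith) (by linarith) (by linarith) (by linarith) (by ring)
        linarith
      · have := (cvar2 α h0 (by linarith)).1 1 1 (4 * α - 3) (by linarith) (by linarith)
          (by linarith) (by linarith) (by linarith) (by linarith) (by ring)
        linarith
end

section
/- Positive CVaR evaluation gap for the CVaR-VI policy: in M★, let π̃★ be the risk-dependent policy with π̃★(s₁,y) = a₁ if y > 1/2, π̃★(s₁,y) = a₂ if y ≤ 1/2, and π̃★(s,y) = a₁ for all s ≠ s₁. Then V^{π̃★}(s₀, 1/2) = 100, the constant family ξ̃ ≡ 1 attains the minima in the value recursion at all reachable augmented states (so the induced policy π̃★_h^{1/2} selects a₂ at s₁), CVaR_{1/2}[Z^{π̃★_h^{1/2}}] = 0, hence the CVaR evaluation gap equals 100 > 0; moreover max_{π_h} CVaR_{1/2}[Z^{π_h}] = 50, so π̃★_h^{1/2} is suboptimal at α = 1/2. -/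
open Finset

section CVaRDefs

attribute [local instance] Classical.propDecidable

variable {S A : Type*}

end CVaRDefs

section PtStar

/-- The risk-dependent policy returned by CVaR value iteration on `M★`:
`a₁` at `s₁` for risk level `y > 1/2`, `a₂` at `s₁` for `y ≤ 1/2`, and `a₁` elsewhere. -/
noncomputable def ptStar : Fin 9 → ℝ → Fin 3 := fun s y =>
  if s = 1 then (if 1 / 2 < y then 0 else 1) else 0

/-- The constant state-level perturbation family `ξ̃ ≡ 1`. -/
noncomputable def constFam : Fin 9 → ℝ → Fin 3 → Fin 9 → ℝ := fun _ _ _ _ => 1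

/-- `ξ̃` attains the minima of the risk-dependent value recursion at every augmented state
reachable (with positive probability) under the induced policy from `(s₀, α)`. -/
noncomputable def AttainsMinOn {S A : Type*} [Fintype S] [Fintype A] [Nonempty S] [Nonempty A]
    (P R : S → A → S → ℝ) (γ : ℝ) (πt : S → ℝ → A) (ξt : S → ℝ → A → S → ℝ)
    (s0 : S) (α : ℝ) (T : ℕ) : Prop :=
  ∀ H : Fin T → A × S, 0 < histProb P s0 (inducedPolicy πt ξt s0 α) H →
    ∀ t : ℕ, t < T →
      Vdp P R γ πt (T - t) (stAt s0 H t) (riskAt ξt s0 α H t) =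
        ∑ s' : S,
          P (stAt s0 H t) (πt (stAt s0 H t) (riskAt ξt s0 α H t)) s' *
            ξt (stAt s0 H t) (riskAt ξt s0 α H t)
              (πt (stAt s0 H t) (riskAt ξt s0 α H t)) s' *
            (R (stAt s0 H t) (πt (stAt s0 H t) (riskAt ξt s0 α H t)) s' +
              γ * Vdp P R γ πt (T - t - 1) s'
                (riskAt ξt s0 α H t *
                  ξt (stAt s0 H t) (riskAt ξt s0 α H t)
                    (πt (stAt s0 H t) (riskAt ξt s0 α H t)) s'))

end PtStar

/-- Sum over two-step histories weighted by the history probability. -/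
theorem aux_sum_s14 (πh : HPolicy (Fin 9) (Fin 3)) (f : (Fin 2 → Fin 3 × Fin 9) → ℝ) :
    ∑ H : Fin 2 → Fin 3 × Fin 9, histProb Pstar 0 πh H * f H =
      ∑ s1 : Fin 9, Pstar 0 (πh 0 Fin.elim0) s1 *
        ∑ s2 : Fin 9, Pstar s1 (πh 1 (fun _ => (πh 0 Fin.elim0, s1))) s2 *
          f ![(πh 0 Fin.elim0, s1), (πh 1 (fun _ => (πh 0 Fin.elim0, s1)), s2)] := by
  have hprob : ∀ (a1 : Fin 3) (s1 : Fin 9) (a2 : Fin 3) (s2 : Fin 9),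
      histProb Pstar 0 πh ![(a1, s1), (a2, s2)] =
        (Pstar 0 a1 s1 * (if a1 = πh 0 Fin.elim0 then 1 else 0)) *
        (Pstar s1 a2 s2 * (if a2 = πh 1 (fun _ => (a1, s1)) then 1 else 0)) := by
    intro a1 s1 a2 s2
    have h0 : pre (![(a1, s1), (a2, s2)] : Fin 2 → Fin 3 × Fin 9) 0 = Fin.elim0 :=
      funext fun i => i.elim0
    have h1 : pre (![(a1, s1), (a2, s2)] : Fin 2 → Fin 3 × Fin 9) 1 = fun _ => (a1, s1) := by
      funext i
      have : i = 0 := Subsingleton.elim _ _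
      subst this
      simp [pre]
    unfold histProb
    rw [Fin.prod_univ_two]
    simp only [Fin.val_zero, Fin.val_one, h0, h1]
    by_cases e1 : a1 = πh 0 Fin.elim0 <;> simp [stAt, e1]
  rw [← (finTwoArrowEquiv (Fin 3 × Fin 9)).symm.sum_comp, Fintype.sum_prod_type]
  simp only [finTwoArrowEquiv_symm_apply]
  rw [Fintype.sum_prod_type, Fintype.sum_eq_single (πh 0 Fin.elim0)]
  · refine Finset.sum_congr rfl fun s1 _ => ?_
    rw [Fintype.sum_prod_type,
      Fintype.sum_eq_single (πh 1 (fun _ => (πh 0 Fin.elim0, s1))), Finset.mul_sum]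
    · refine Finset.sum_congr rfl fun s2 _ => ?_
      rw [hprob]
      simp
      ring
    · intro a2 h2
      refine Finset.sum_eq_zero fun s2 _ => ?_
      rw [hprob]
      simp [h2]
  · intro a1 h1
    refine Finset.sum_eq_zero fun s1 _ => ?_
    refine Finset.sum_eq_zero fun x _ => ?_
    obtain ⟨a2, s2⟩ := x
    rw [hprob]
    simp [h1]

theorem aux_sum_zero (a : Fin 3) (g : Fin 9 → ℝ) :
    ∑ s, Pstar 0 a s * g s = 1 / 2 * g 1 + 1 / 2 * g 2 := by
  simp +decide [Fin.sum_univ_succ, Pstar]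

theorem aux_sum_one_zero (g : Fin 9 → ℝ) :
    ∑ s, Pstar 1 0 s * g s = 3 / 4 * g 3 + 1 / 4 * g 4 := by
  simp +decide [Fin.sum_univ_succ, Pstar]

theorem aux_sum_one_one (g : Fin 9 → ℝ) :
    ∑ s, Pstar 1 1 s * g s = g 5 := by
  simp +decide [Fin.sum_univ_succ, Pstar]

theorem aux_sum_one_two (g : Fin 9 → ℝ) :
    ∑ s, Pstar 1 2 s * g s = 1 / 2 * g 6 + 1 / 2 * g 7 := by
  simp +decide [Fin.sum_univ_succ, Pstar]

theorem aux_sum_two (a : Fin 3) (g : Fin 9 → ℝ) :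
    ∑ s, Pstar 2 a s * g s = g 8 := by
  simp +decide [Fin.sum_univ_succ, Pstar]

theorem aux_sum_self (s : Fin 9) (h0 : s ≠ 0) (h1 : s ≠ 1) (h2 : s ≠ 2) (a : Fin 3)
    (g : Fin 9 → ℝ) : ∑ s', Pstar s a s' * g s' = g s := by
  simp [Pstar, h0, h1, h2]

theorem aux_sum_P (s : Fin 9) (a : Fin 3) : ∑ s', Pstar s a s' = 1 := by
  have key : ∑ s', Pstar s a s' * (fun _ => (1 : ℝ)) s' = 1 := by
    by_cases h0 : s = 0
    · subst h0; rw [aux_sum_zero]; norm_num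
    by_cases h1 : s = 1
    · subst h1
      fin_cases a
      · exact (aux_sum_one_zero _).trans (by norm_num)
      · exact (aux_sum_one_one _)
      · exact (aux_sum_one_two _).trans (by norm_num)
    by_cases h2 : s = 2
    · subst h2; rw [aux_sum_two]
    rw [aux_sum_self s h0 h1 h2]
  simpa using key

theorem aux_valid : ValidFamily Pstar constFam := by
  refine ⟨fun s y a hy hy1 => ⟨fun s' => ⟨by simp [constFam], ?_⟩, ?_⟩, fun _ _ _ => rfl⟩
  · rw [constFam, le_div_iff₀ hy]; linarith
  · simpa [constFam] using aux_sum_P s a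

theorem aux_ret (a1 a2 : Fin 3) (s1 s2 : Fin 9) :
    ret Rstar 1 0 ![(a1, s1), (a2, s2)] = Rstar s1 a2 s2 := by
  simp [ret, Fin.sum_univ_two, stAt, Rstar]

/-- Static CVaR of an arbitrary policy. -/
theorem aux_cvar (πh : HPolicy (Fin 9) (Fin 3)) :
    staticCVaR Pstar Rstar 1 0 2 πh (1 / 2) =
      if πh 1 (fun _ => (πh 0 Fin.elim0, 1)) = 2 then 50 else 0 := by
  unfold staticCVaR RiskEnv
  simp only [mul_assoc, aux_sum_s14, aux_sum_zero, aux_sum_two, aux_ret]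
  generalize πh 1 (fun _ => (πh 0 Fin.elim0, 2)) = c
  generalize πh 0 Fin.elim0 = a
  generalize πh 1 (fun _ => (a, 1)) = b
  have hR : Rstar 2 c 8 = 200 := by simp [Rstar]
  rw [hR]
  apply IsLeast.csInf_eq
  fin_cases b
  · have r3 : Rstar 1 0 3 = 600 := by simp [Rstar]
    have r4 : Rstar 1 0 4 = -600 := by simp [Rstar]
    simp only [Fin.zero_eta, aux_sum_one_zero, r3, r4]
    constructor
    · refine ⟨fun H => ![0, 0, 0, 0, 2, 0, 0, 0, 3 / 2] (H 1).2, ⟨fun H => ?_, ?_⟩, ?_⟩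
      · beta_reduce
        generalize (H 1).2 = s
        fin_cases s <;> norm_num
      · simp; norm_num
      · simp; norm_num
    · rintro x ⟨ξ, ⟨hb, hs⟩, rfl⟩
      have b3 := hb ![(a, 1), (0, 3)]
      have b4 := hb ![(a, 1), (0, 4)]
      have b8 := hb ![(a, 2), (c, 8)]
      simp
      linarith [b3.1, b3.2, b4.1, b4.2, b8.1, b8.2]
  · have r5 : Rstar 1 1 5 = 0 := by simp [Rstar]
    simp only [Fin.mk_one, aux_sum_one_one, r5]
    constructor
    · refine ⟨fun H => ![0, 0, 0, 0, 0, 2, 0, 0, 0] (H 1).2, ⟨fun H => ?_, ?_⟩, ?_⟩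
      · beta_reduce
        generalize (H 1).2 = s
        fin_cases s <;> norm_num
      · simp
      · simp
    · rintro x ⟨ξ, ⟨hb, hs⟩, rfl⟩
      have b8 := hb ![(a, 2), (c, 8)]
      simp
      linarith [b8.1, b8.2]
  · have r6 : Rstar 1 2 6 = -100 := by simp [Rstar]
    have r7 : Rstar 1 2 7 = 400 := by simp [Rstar]
    simp only [Fin.reduceFinMk, aux_sum_one_two, r6, r7]
    constructor
    · refine ⟨fun H => ![0, 0, 0, 0, 0, 0, 2, 0, 1] (H 1).2, ⟨fun H => ?_, ?_⟩, ?_⟩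
      · beta_reduce
        generalize (H 1).2 = s
        fin_cases s <;> norm_num
      · simp; norm_num
      · simp; norm_num
    · rintro x ⟨ξ, ⟨hb, hs⟩, rfl⟩
      have b6 := hb ![(a, 1), (2, 6)]
      have b7 := hb ![(a, 1), (2, 7)]
      have b8 := hb ![(a, 2), (c, 8)]
      simp
      linarith [b6.1, b6.2, b7.1, b7.2, b8.1, b8.2]

theorem aux_V1_two (y : ℝ) (hy : 0 < y) (hy1 : y ≤ 1) :
    Vdp Pstar Rstar 1 ptStar 1 2 y = 200 := by
  have hR : ∀ a, Rstar 2 a 8 = 200 := by intro a; simp [Rstar]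
  simp only [Vdp, RiskEnv, mul_assoc, aux_sum_two, hR]
  apply IsLeast.csInf_eq
  constructor
  · refine ⟨fun _ => 1, ⟨fun _ => ⟨zero_le_one, ?_⟩, rfl⟩, by norm_num⟩
    rw [le_div_iff₀ hy]; linarith
  · rintro x ⟨ξ, ⟨hb, hs⟩, rfl⟩
    rw [hs]; norm_num

theorem aux_V1_one_low (y : ℝ) (hy : 0 < y) (hy1 : y ≤ 1 / 2) :
    Vdp Pstar Rstar 1 ptStar 1 1 y = 0 := by
  have hp : ptStar 1 y = 1 := by simp [ptStar]; linarith
  have hR : Rstar 1 1 5 = 0 := by simp [Rstar]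
  simp only [Vdp, RiskEnv, mul_assoc, hp, aux_sum_one_one, hR]
  apply IsLeast.csInf_eq
  constructor
  · refine ⟨fun _ => 1, ⟨fun _ => ⟨zero_le_one, ?_⟩, rfl⟩, by norm_num⟩
    rw [le_div_iff₀ hy]; linarith
  · rintro x ⟨ξ, ⟨hb, hs⟩, rfl⟩
    simp

theorem aux_V1_one_high (y : ℝ) (hy : 1 / 2 < y) (hy1 : y ≤ 1) :
    600 - 300 / y ≤ Vdp Pstar Rstar 1 ptStar 1 1 y := by
  have hp : ptStar 1 y = 0 := by simp only [ptStar, if_true, if_pos hy]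
  have r3 : Rstar 1 0 3 = 600 := by simp [Rstar]
  have r4 : Rstar 1 0 4 = -600 := by simp [Rstar]
  simp only [Vdp, RiskEnv, mul_assoc, hp, aux_sum_one_zero, r3, r4]
  apply le_csInf
  · refine ⟨_, fun _ => 1, ⟨fun _ => ⟨zero_le_one, ?_⟩, by norm_num⟩, rfl⟩
    rw [le_div_iff₀ (by linarith)]; linarith
  · rintro x ⟨ξ, ⟨hb, hs⟩, rfl⟩
    have b4 := (hb 4).2
    have e : 300 / y = 300 * (1 / y) := by ring
    rw [e]
    linarith

theorem aux_V2 : Vdp Pstar Rstar 1 ptStar 2 0 (1 / 2) = 100 := by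
  have hR : ∀ a s, Rstar 0 a s = 0 := by intro a s; simp [Rstar]
  rw [Vdp]
  simp only [RiskEnv, mul_assoc, aux_sum_zero, hR]
  apply IsLeast.csInf_eq
  constructor
  · refine ⟨fun _ => 1, ⟨fun _ => by norm_num, by norm_num⟩, ?_⟩
    rw [aux_V1_two _ (by norm_num) (by norm_num), aux_V1_one_low _ (by norm_num) (by norm_num)]
    norm_num
  · rintro x ⟨ξ, ⟨hb, hs⟩, rfl⟩
    have b1 := hb 1
    have b2 := hb 2
    have h2 : ξ 2 * Vdp Pstar Rstar 1 ptStar 1 2 (1 / 2 * ξ 2) = ξ 2 * 200 := by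
      rcases b2.1.eq_or_lt with h | h
      · rw [← h]; simp
      · rw [aux_V1_two _ (by linarith) (by linarith [b2.2])]
    have h1 : 200 * ξ 1 - 200 ≤ ξ 1 * Vdp Pstar Rstar 1 ptStar 1 1 (1 / 2 * ξ 1) := by
      rcases b1.1.eq_or_lt with h | h
      · rw [← h]; simp
      · rcases le_or_gt (ξ 1) 1 with h' | h'
        · rw [aux_V1_one_low _ (by linarith) (by linarith)]; linarith
        · have := aux_V1_one_high (1 / 2 * ξ 1) (by linarith) (by linarith [b1.2])
          have h3 := mul_le_mul_of_nonneg_left this h.le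
          have h4 : ξ 1 * (600 - 300 / (1 / 2 * ξ 1)) = 600 * ξ 1 - 600 := by
            field_simp; ring
          linarith
    simp only [zero_add, one_mul]
    rw [h2]
    linarith

theorem aux_induced (H : Fin 1 → Fin 3 × Fin 9) (h : stAt 0 H 1 = 1) :
    inducedPolicy ptStar constFam 0 (1 / 2) 1 H = 1 := by
  simp only [inducedPolicy, h]
  simp [ptStar, riskAt, constFam]

theorem aux_cvar_induced :
    staticCVaR Pstar Rstar 1 0 2 (inducedPolicy ptStar constFam 0 (1 / 2)) (1 / 2) = 0 := by
  rw [aux_cvar, aux_induced _ (by simp [stAt])]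
  simp

theorem aux_sup : sSup {x : ℝ | ∃ πh : HPolicy (Fin 9) (Fin 3),
    x = staticCVaR Pstar Rstar 1 0 2 πh (1 / 2)} = 50 := by
  apply IsGreatest.csSup_eq
  constructor
  · exact ⟨piConst 2, by rw [aux_cvar]; simp [piConst]⟩
  · rintro x ⟨πh, rfl⟩
    rw [aux_cvar]
    split_ifs <;> norm_num

theorem aux_attains : AttainsMinOn Pstar Rstar 1 ptStar constFam 0 (1 / 2) 2 := by
  intro H hH t ht
  have hr : ∀ k, riskAt constFam 0 (1 / 2) H k = 1 / 2 := by
    intro k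
    induction k with
    | zero => rfl
    | succ k ih => rw [riskAt, ih]; simp [constFam]
  rw [hr]
  interval_cases t
  · simp only [stAt, mul_assoc, aux_sum_zero]
    simp only [constFam, mul_one, Nat.sub_zero, aux_V2]
    norm_num
    rw [aux_V1_two _ (by norm_num) (by norm_num), aux_V1_one_low _ (by norm_num) (by norm_num)]
    have hR : ∀ a s, Rstar 0 a s = 0 := by intro a s; simp +decide [Rstar]
    simp only [hR]
    norm_num
  · have hs : stAt 0 H 1 = 1 ∨ stAt 0 H 1 = 2 := by
      by_contra hcon
      push Not at hcon
      have : histProb Pstar 0 (inducedPolicy ptStar constFam 0 (1 / 2)) H = 0 := by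
        unfold histProb
        rw [Fin.prod_univ_two]
        have h1 : (H 0).2 ≠ 1 := hcon.1
        have h2 : (H 0).2 ≠ 2 := hcon.2
        simp [stAt, Pstar, h1, h2]
      exact absurd hH (by rw [this]; exact lt_irrefl _)
    rcases hs with hs | hs
    · have hp : ptStar 1 (1 / 2) = 1 := by simp [ptStar]
      simp only [hs, mul_assoc, hp, aux_sum_one_one]
      rw [aux_V1_one_low _ (by norm_num) (by norm_num)]
      simp [Vdp, Rstar]
    · simp only [hs, mul_assoc, aux_sum_two]
      rw [aux_V1_two _ (by norm_num) (by norm_num)]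
      simp [Vdp, Rstar, constFam]

/-- positive CVaR evaluation gap for the CVaR-VI policy:
in `M★`, for the risk-dependent policy `π̃★` (`ptStar`):
`V^{π̃★}(s₀, 1/2) = 100`; the constant family `ξ̃ ≡ 1` is a valid family attaining the
minima of the value recursion at all reachable augmented states (so the induced policy
`π̃★_h^{1/2}` selects `a₂` at `s₁`); `CVaR_{1/2}[Z^{π̃★_h^{1/2}}] = 0`, hence the CVaR
evaluation gap equals `100 > 0`; moreover `max_{π_h} CVaR_{1/2}[Z^{π_h}] = 50`, so
`π̃★_h^{1/2}` is suboptimal at `α = 1/2`. -/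
theorem stmt14 :
    Vdp Pstar Rstar 1 ptStar 2 0 (1 / 2) = 100 ∧
    ValidFamily Pstar constFam ∧
    AttainsMinOn Pstar Rstar 1 ptStar constFam 0 (1 / 2) 2 ∧
    (∀ H : Fin 1 → Fin 3 × Fin 9, stAt 0 H 1 = 1 →
      inducedPolicy ptStar constFam 0 (1 / 2) 1 H = 1) ∧
    staticCVaR Pstar Rstar 1 0 2 (inducedPolicy ptStar constFam 0 (1 / 2)) (1 / 2) = 0 ∧
    Vdp Pstar Rstar 1 ptStar 2 0 (1 / 2) -
        staticCVaR Pstar Rstar 1 0 2 (inducedPolicy ptStar constFam 0 (1 / 2)) (1 / 2) =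
      100 ∧
    sSup {x : ℝ | ∃ πh : HPolicy (Fin 9) (Fin 3),
        x = staticCVaR Pstar Rstar 1 0 2 πh (1 / 2)} = 50 ∧
    staticCVaR Pstar Rstar 1 0 2 (inducedPolicy ptStar constFam 0 (1 / 2)) (1 / 2) <
      sSup {x : ℝ | ∃ πh : HPolicy (Fin 9) (Fin 3),
        x = staticCVaR Pstar Rstar 1 0 2 πh (1 / 2)} := by
  refine ⟨aux_V2, aux_valid, aux_attains, aux_induced, aux_cvar_induced, ?_, aux_sup, ?_⟩
  · rw [aux_V2, aux_cvar_induced]; norm_num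
  · rw [aux_sup, aux_cvar_induced]; norm_num
end
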